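/- Let G and H be rayless graphs, let X ⊆ V(G) and Y ⊆ V(H) be finite vertex sets, suppose the pairs (G,X) and (H,Y) are strong twins, and suppose both G − X and H − Y are connected. Then there exist infinitely many pairwise non-isomorphic pairs (H',Y') with H' − Y' connected, each of which is a strong twin of (G,X). -/

import Mathlib

/-- A graph is rayless if it contains no ray, i.e. no infinite sequence of distinct
vertices `v₀, v₁, v₂, …` with `vᵢ` adjacent to `vᵢ₊₁` for all `i`. -/
def SimpleGraph.IsRayless {V : Type*} (G : SimpleGraph V) : Prop :=
  ¬ ∃ f : ℕ → V, Function.Injective f ∧ ∀ n, G.Adj (f n) (f (n + 1))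

/-- Two pairs `(G, X)` and `(H, Y)` are isomorphic if there is a graph isomorphism
`γ : G ≃g H` with `γ(X) = Y`. -/
def PairIso {V W : Type*} (G : SimpleGraph V) (X : Set V)
    (H : SimpleGraph W) (Y : Set W) : Prop :=
  ∃ γ : G ≃g H, ⇑γ '' X = Y

/-- Two pairs `(G, X)` and `(H, Y)` are strong twins if they are not isomorphic as
pairs, yet there are graph embeddings `φ : G ↪g H` with `φ(X) ⊆ Y` and
`ψ : H ↪g G` with `ψ(Y) ⊆ X`. -/
def StrongTwinPairs {V W : Type*} (G : SimpleGraph V) (X : Set V)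
    (H : SimpleGraph W) (Y : Set W) : Prop :=
  ¬ PairIso G X H Y ∧ (∃ φ : G ↪g H, ⇑φ '' X ⊆ Y) ∧ (∃ ψ : H ↪g G, ⇑ψ '' Y ⊆ X)

universe u
/-! ### Connected sets -/

/-- A vertex set is connected if it is nonempty and has no nontrivial cut without edges. -/
def Cn {V : Type*} (G : SimpleGraph V) (W : Set V) : Prop :=
  W.Nonempty ∧ ∀ M : Set V, M ⊆ W → M.Nonempty →
    (∀ a ∈ M, ∀ b ∈ W, G.Adj a b → b ∈ M) → W ⊆ M

theorem Cn.image {V W : Type*} {G : SimpleGraph V} {H : SimpleGraph W} (f : V → W)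
    (hadj : ∀ x y, H.Adj (f x) (f y) ↔ G.Adj x y) {U : Set V} (hU : Cn G U) :
    Cn H (f '' U) := by
  refine ⟨hU.1.image f, ?_⟩
  intro M hM hne hcl
  have := hU.2 (f ⁻¹' M ∩ U) Set.inter_subset_right ?_ ?_
  · rintro _ ⟨x, hx, rfl⟩
    exact (this hx).1
  · obtain ⟨m, hm⟩ := hne
    obtain ⟨x, hx, rfl⟩ := hM hm
    exact ⟨x, hm, hx⟩
  · rintro a ⟨ha, _⟩ b hb hab
    exact ⟨hcl _ ha _ ⟨b, hb, rfl⟩ ((hadj _ _).2 hab), hb⟩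

theorem Cn.of_image {V W : Type*} {G : SimpleGraph V} {H : SimpleGraph W} (f : V → W)
    (hinj : Function.Injective f)
    (hadj : ∀ x y, H.Adj (f x) (f y) ↔ G.Adj x y) {U : Set V} (hU : Cn H (f '' U)) :
    Cn G U := by
  refine ⟨Set.image_nonempty.1 hU.1, ?_⟩
  intro M hM hne hcl
  have := hU.2 (f '' M) (Set.image_mono hM) (hne.image f) ?_
  · exact (Set.image_subset_image_iff hinj).1 this
  · rintro _ ⟨a, ha, rfl⟩ _ ⟨b, hb, rfl⟩ hab
    exact ⟨b, hcl a ha b hb ((hadj _ _).1 hab), rfl⟩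

theorem Cn.singleton {V : Type*} (G : SimpleGraph V) (e : V) : Cn G {e} := by
  refine ⟨⟨e, rfl⟩, ?_⟩
  rintro M hM ⟨m, hm⟩ - x rfl
  have : m = x := hM hm
  exact this ▸ hm

/-- The component of `e` inside `U`. -/
def comp {V : Type*} (G : SimpleGraph V) (U : Set V) (e : V) : Set V :=
  {v | ∃ W, Cn G W ∧ W ⊆ U ∧ e ∈ W ∧ v ∈ W}

theorem comp_sub {V : Type*} (G : SimpleGraph V) (U : Set V) (e : V) : comp G U e ⊆ U := by
  rintro v ⟨W, -, h, -, hv⟩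
  exact h hv

theorem mem_comp {V : Type*} (G : SimpleGraph V) {U : Set V} {e : V} (he : e ∈ U) :
    e ∈ comp G U e :=
  ⟨{e}, Cn.singleton G e, by simpa using he, rfl, rfl⟩

theorem comp_cn {V : Type*} (G : SimpleGraph V) {U : Set V} {e : V} (he : e ∈ U) :
    Cn G (comp G U e) := by
  refine ⟨⟨e, mem_comp G he⟩, ?_⟩
  intro M hM hne hcl
  have key : ∀ W, Cn G W → W ⊆ U → e ∈ W → (M ∩ W).Nonempty → W ⊆ M := by
    intro W hW hWU heW hMW
    have := hW.2 (M ∩ W) Set.inter_subset_right hMW ?_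
    · exact fun x hx => (this hx).1
    · rintro a ⟨ha, _⟩ b hb hab
      exact ⟨hcl a ha b ⟨W, hW, hWU, heW, hb⟩ hab, hb⟩
  have he' : e ∈ M := by
    obtain ⟨m, hm⟩ := hne
    obtain ⟨W, hW, hWU, heW, hmW⟩ := hM hm
    exact key W hW hWU heW ⟨m, hm, hmW⟩ heW
  rintro v ⟨W, hW, hWU, heW, hv⟩
  exact key W hW hWU heW ⟨e, he', heW⟩ hv

theorem Cn.insert {V : Type*} {G : SimpleGraph V} {W : Set V} (hW : Cn G W) {a b : V}
    (ha : a ∈ W) (hab : G.Adj a b) : Cn G (insert b W) := by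
  refine ⟨⟨b, Or.inl rfl⟩, ?_⟩
  intro M hM hne hcl
  have haM : a ∈ M := by
    obtain ⟨m, hm⟩ := hne
    rcases hM hm with rfl | hmW
    · exact hcl m hm a (Or.inr ha) hab.symm
    · have := hW.2 (M ∩ W) Set.inter_subset_right ⟨m, hm, hmW⟩ ?_
      · exact (this ha).1
      · rintro x ⟨hx, _⟩ y hy hxy
        exact ⟨hcl x hx y (Or.inr hy) hxy, hy⟩
  have h1 : W ⊆ M := by
    have := hW.2 (M ∩ W) Set.inter_subset_right ⟨a, haM, ha⟩ ?_
    · exact fun x hx => (this hx).1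
    · rintro x ⟨hx, _⟩ y hy hxy
      exact ⟨hcl x hx y (Or.inr hy) hxy, hy⟩
  rintro x (rfl | hx)
  · exact hcl a haM x (Or.inl rfl) hab
  · exact h1 hx

theorem comp_adj {V : Type*} (G : SimpleGraph V) {U : Set V} {e a b : V} (he : e ∈ U)
    (ha : a ∈ comp G U e) (hb : b ∈ U) (hab : G.Adj a b) : b ∈ comp G U e :=
  ⟨insert b (comp G U e), (comp_cn G he).insert ha hab,
    Set.insert_subset hb (comp_sub G U e), Or.inr (mem_comp G he), Or.inl rfl⟩

theorem comp_max {V : Type*} (G : SimpleGraph V) {U W : Set V} {e : V} (he : e ∈ W)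
    (hW : Cn G W) (hWU : W ⊆ U) : W ⊆ comp G U e :=
  fun _ hx => ⟨W, hW, hWU, he, hx⟩

theorem comp_eq {V : Type*} (G : SimpleGraph V) {U : Set V} {e a : V} (he : e ∈ U)
    (ha : a ∈ comp G U e) : comp G U a = comp G U e := by
  have h1 := comp_max G ha (comp_cn G he) (comp_sub G U e)
  refine Set.Subset.antisymm ?_ h1
  exact comp_max G (h1 (mem_comp G he)) (comp_cn G (comp_sub G U e ha)) (comp_sub G U a)

/-- A component of `U \ S` inside a connected `U` meeting `S` has an edge to `S`. -/
theorem comp_edge {V : Type*} (G : SimpleGraph V) {U S : Set V} {e s : V} (hU : Cn G U)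
    (he : e ∈ U \ S) (hs : s ∈ U) (hsS : s ∈ S) :
    ∃ a ∈ comp G (U \ S) e, ∃ t ∈ U, t ∈ S ∧ G.Adj a t := by
  by_contra hcon
  push Not at hcon
  have := hU.2 (comp G (U \ S) e) (fun x hx => (comp_sub G _ e hx).1) ⟨e, mem_comp G he⟩ ?_
  · exact (comp_sub G _ e (this hs)).2 hsS
  · intro a ha b hb hab
    by_cases hbS : b ∈ S
    · exact absurd hab (hcon a ha b hb hbS)
    · exact comp_adj G he ha ⟨hb, hbS⟩ hab

theorem connected_iff_cn {V : Type*} (G : SimpleGraph V) : G.Connected ↔ Cn G Set.univ := by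
  constructor
  · intro h
    obtain ⟨x⟩ := h.nonempty
    refine ⟨⟨x, trivial⟩, ?_⟩
    rintro M - ⟨m, hm⟩ hcl y -
    obtain ⟨p⟩ := h.preconnected m y
    induction p with
    | nil => exact hm
    | cons hadj _ ih => exact ih (hcl _ hm _ trivial hadj)
  · rintro ⟨⟨x, -⟩, h⟩
    have : Nonempty V := ⟨x⟩
    refine SimpleGraph.Connected.mk ?_
    intro a b
    refine h {v | G.Reachable a v} (Set.subset_univ _) ⟨a, SimpleGraph.Reachable.refl a⟩ ?_
      (Set.mem_univ b)
    intro v hv w _ hvw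
    exact SimpleGraph.Reachable.trans hv hvw.reachable

/-! ### Rank -/

/-- Schmidt's rank. -/
inductive Rk {V : Type u} (G : SimpleGraph V) : Ordinal.{u} → Set V → Prop
  | mk (α : Ordinal.{u}) (U S : Set V) (hS : S.Finite) (r : Set V → Ordinal.{u})
      (hr : ∀ W, Cn G W → W ⊆ U → Disjoint W S → r W < α)
      (h : ∀ W, Cn G W → W ⊆ U → Disjoint W S → Rk G (r W) W) : Rk G α U

theorem rk_iff {V : Type u} {G : SimpleGraph V} {α : Ordinal.{u}} {U : Set V} :
    Rk G α U ↔ ∃ S : Set V, S.Finite ∧ ∀ W, Cn G W → W ⊆ U → Disjoint W S →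
      ∃ β < α, Rk G β W := by
  constructor
  · rintro ⟨_, _, S, hS, r, hr, h⟩
    exact ⟨S, hS, fun W h1 h2 h3 => ⟨r W, hr W h1 h2 h3, h W h1 h2 h3⟩⟩
  · rintro ⟨S, hS, h⟩
    classical
    refine Rk.mk α U S hS
      (fun W => if hh : Cn G W ∧ W ⊆ U ∧ Disjoint W S then
        (h W hh.1 hh.2.1 hh.2.2).choose else 0) ?_ ?_
    · intro W h1 h2 h3
      have hh : Cn G W ∧ W ⊆ U ∧ Disjoint W S := ⟨h1, h2, h3⟩
      rw [dif_pos hh]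
      exact (h W h1 h2 h3).choose_spec.1
    · intro W h1 h2 h3
      have hh : Cn G W ∧ W ⊆ U ∧ Disjoint W S := ⟨h1, h2, h3⟩
      rw [dif_pos hh]
      exact (h W h1 h2 h3).choose_spec.2

theorem Rk.pullback {V W : Type u} {G : SimpleGraph V} {H : SimpleGraph W} (f : V → W)
    (hinj : Function.Injective f)
    (hadj : ∀ x y, H.Adj (f x) (f y) ↔ G.Adj x y) (α : Ordinal.{u}) :
    ∀ (U : Set V) (U' : Set W), f '' U ⊆ U' → Rk H α U' → Rk G α U := by
  induction α using WellFoundedLT.induction with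
  | ind α ih =>
    intro U U' hUU h
    rw [rk_iff] at h ⊢
    obtain ⟨S, hS, h⟩ := h
    refine ⟨f ⁻¹' S, hS.preimage hinj.injOn, ?_⟩
    intro D hD hDU hDS
    obtain ⟨β, hβ, hR⟩ := h (f '' D) (hD.image f hadj) ((Set.image_mono hDU).trans hUU) (by
      rw [Set.disjoint_left]
      rintro _ ⟨x, hx, rfl⟩ hxS
      exact Set.disjoint_left.1 hDS hx hxS)
    exact ⟨β, hβ, ih β hβ D _ subset_rfl hR⟩

theorem Rk.mono {V : Type u} {G : SimpleGraph V} {α : Ordinal.{u}} {U U' : Set V}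
    (h : Rk G α U') (hU : U ⊆ U') : Rk G α U :=
  h.pullback id Function.injective_id (fun _ _ => Iff.rfl) α U U' (by simpa using hU)

theorem Rk.mono_ord {V : Type u} {G : SimpleGraph V} {α β : Ordinal.{u}} {U : Set V}
    (h : Rk G α U) (hab : α ≤ β) : Rk G β U := by
  rw [rk_iff] at h ⊢
  obtain ⟨S, hS, h⟩ := h
  refine ⟨S, hS, fun W h1 h2 h3 => ?_⟩
  obtain ⟨γ, hγ, h⟩ := h W h1 h2 h3
  exact ⟨γ, hγ.trans_le hab, h⟩

theorem exists_unranked {V : Type u} {G : SimpleGraph V} {U : Set V} (hU : ∀ α, ¬ Rk G α U)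
    (S : Set V) (hS : S.Finite) : ∃ W, Cn G W ∧ W ⊆ U ∧ Disjoint W S ∧ ∀ α, ¬ Rk G α W := by
  by_contra hcon
  push Not at hcon
  have : ∀ W : Set V, ∃ α : Ordinal.{u}, Cn G W → W ⊆ U → Disjoint W S → Rk G α W := by
    intro W
    by_cases hh : Cn G W ∧ W ⊆ U ∧ Disjoint W S
    · obtain ⟨α, h⟩ := hcon W hh.1 hh.2.1 hh.2.2
      exact ⟨α, fun _ _ _ => h⟩
    · exact ⟨0, fun h1 h2 h3 => absurd ⟨h1, h2, h3⟩ hh⟩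
  choose r hr using this
  refine hU (Order.succ (⨆ W, r W)) (Rk.mk _ _ S hS r ?_ ?_)
  · intro W _ _ _
    exact Order.lt_succ_of_le (Ordinal.le_iSup r W)
  · exact fun W => hr W

theorem rayless_ranked {V : Type u} (G : SimpleGraph V) (hG : G.IsRayless) :
    ∃ α, Rk G α Set.univ := by
  by_contra hcon
  push Not at hcon
  apply hG
  obtain ⟨U, hUc, -, -, hU⟩ := exists_unranked hcon ∅ Set.finite_empty
  let St := {p : V × Set V // p.1 ∉ p.2 ∧ Cn G p.2 ∧ (∀ α, ¬ Rk G α p.2) ∧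
    ∃ m ∈ p.2, G.Adj p.1 m}
  have key : ∀ (M : Set V) (m : V), m ∈ M → Cn G M → (∀ α, ¬ Rk G α M) →
      ∃ s : St, s.1.1 = m ∧ s.1.2 ⊆ M \ {m} := by
    intro M m hm hM hMr
    obtain ⟨W, hWc, hWM, hWm, hWr⟩ := exists_unranked hMr {m} (Set.finite_singleton m)
    obtain ⟨e, he⟩ := hWc.1
    have hWM' : W ⊆ M \ {m} := fun x hx => ⟨hWM hx, Set.disjoint_left.1 hWm hx⟩
    obtain ⟨a, ha, t, -, ht, hat⟩ := comp_edge G (S := {m}) hM (hWM' he) hm rfl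
    rw [Set.mem_singleton_iff] at ht
    subst ht
    refine ⟨⟨(t, comp G (M \ {t}) e), ?_, comp_cn G (hWM' he), ?_, a, ha, hat.symm⟩, rfl,
      comp_sub G _ e⟩
    · intro h
      exact (comp_sub G _ e h).2 rfl
    · intro α h
      exact hWr α (h.mono (comp_max G he hWc hWM'))
  have step : ∀ s : St, ∃ s' : St, s'.1.1 ∈ s.1.2 ∧ s'.1.2 ⊆ s.1.2 ∧ G.Adj s.1.1 s'.1.1 := by
    rintro ⟨⟨v, M⟩, hv, hM, hMr, m, hm, hvm⟩
    obtain ⟨s', h1, h2⟩ := key M m hm hM hMr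
    refine ⟨s', ?_, fun x hx => (h2 hx).1, ?_⟩
    · rw [h1]; exact hm
    · rw [h1]; exact hvm
  choose nx h1 h2 h3 using step
  obtain ⟨u, hu⟩ := hUc.1
  obtain ⟨s0, -, -⟩ := key U u hu hUc hU
  let s : ℕ → St := fun n => nx^[n] s0
  have hs : ∀ n, s (n + 1) = nx (s n) := fun n => Function.iterate_succ_apply' nx n s0
  have hmono : ∀ n k, (s (n + k)).1.2 ⊆ (s n).1.2 := by
    intro n k
    induction k with
    | zero => exact subset_rfl
    | succ k ih =>
      rw [← add_assoc, hs]
      exact (h2 _).trans ih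
  have hlt : ∀ n m, n < m → (s n).1.1 ≠ (s m).1.1 := by
    intro n m hnm heq
    obtain ⟨k, rfl⟩ := Nat.exists_eq_add_of_lt hnm
    apply (s n).2.1
    rw [heq, hs]
    exact hmono n k (h1 _)
  refine ⟨fun n => (s n).1.1, ?_, ?_⟩
  · intro n m h
    by_contra hne
    rcases lt_or_gt_of_ne hne with h' | h'
    · exact hlt _ _ h' h
    · exact hlt _ _ h' h.symm
  · intro n
    show G.Adj (s n).1.1 (s (n + 1)).1.1
    rw [hs]
    exact h3 _

/-! ### Kernel -/

/-- Finite separators into pieces of smaller rank. -/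
def Good {V : Type u} (G : SimpleGraph V) (α : Ordinal.{u}) (S : Set V) : Prop :=
  S.Finite ∧ ∀ W, Cn G W → Disjoint W S → ∃ β < α, Rk G β W

theorem Good.inter {V : Type u} {G : SimpleGraph V} {α : Ordinal.{u}} {S S' : Set V}
    (h : Good G α S) (h' : Good G α S') : Good G α (S ∩ S') := by
  refine ⟨h.1.subset Set.inter_subset_left, ?_⟩
  intro W hW hWd
  have hTfin : ((S ∪ S') ∩ W).Finite := (h.1.union h'.1).subset Set.inter_subset_left
  by_cases hne : ((S ∪ S') ∩ W).Nonempty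
  swap
  · refine h.2 W hW ?_
    rw [Set.disjoint_left]
    intro x hx hxS
    exact hne ⟨x, Or.inl hxS, hx⟩
  obtain ⟨t0, ht0S, ht0W⟩ := hne
  -- a finite family of sets of smaller rank
  have hfam : ∀ t : V, t ∈ (S ∪ S') ∩ W → ∃ β < α, ∃ Q Q' : Set V,
      Rk G β Q ∧ Rk G β Q' ∧ (t ∉ S → Q = comp G (W \ S) t) ∧
      (t ∉ S' → Q' = comp G (W \ S') t) := by
    rintro t ⟨-, htW⟩
    have hα : ∃ β, β < α ∧ Rk G β ∅ := by
      by_cases htS : t ∈ S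
      · have htS' : t ∉ S' := fun hh => Set.disjoint_left.1 hWd htW ⟨htS, hh⟩
        obtain ⟨β, hβ, hR⟩ := h'.2 {t} (Cn.singleton G t) (by simpa using htS')
        exact ⟨β, hβ, hR.mono (Set.empty_subset _)⟩
      · obtain ⟨β, hβ, hR⟩ := h.2 {t} (Cn.singleton G t) (by simpa using htS)
        exact ⟨β, hβ, hR.mono (Set.empty_subset _)⟩
    have hA : ∃ β < α, ∃ Q, Rk G β Q ∧ (t ∉ S → Q = comp G (W \ S) t) := by
      by_cases htS : t ∈ S
      · obtain ⟨β, hβ, hR⟩ := hα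
        exact ⟨β, hβ, ∅, hR, fun hh => absurd htS hh⟩
      · obtain ⟨β, hβ, hR⟩ := h.2 (comp G (W \ S) t) (comp_cn G ⟨htW, htS⟩)
          (Set.disjoint_left.2 fun x hx => (comp_sub G _ t hx).2)
        exact ⟨β, hβ, _, hR, fun _ => rfl⟩
    have hB : ∃ β < α, ∃ Q, Rk G β Q ∧ (t ∉ S' → Q = comp G (W \ S') t) := by
      by_cases htS : t ∈ S'
      · obtain ⟨β, hβ, hR⟩ := hα
        exact ⟨β, hβ, ∅, hR, fun hh => absurd htS hh⟩
      · obtain ⟨β, hβ, hR⟩ := h'.2 (comp G (W \ S') t) (comp_cn G ⟨htW, htS⟩)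
          (Set.disjoint_left.2 fun x hx => (comp_sub G _ t hx).2)
        exact ⟨β, hβ, _, hR, fun _ => rfl⟩
    obtain ⟨β, hβ, Q, hQ, hQ'⟩ := hA
    obtain ⟨γ, hγ, R, hR, hR'⟩ := hB
    exact ⟨max β γ, max_lt hβ hγ, Q, R, hQ.mono_ord (le_max_left _ _),
      hR.mono_ord (le_max_right _ _), hQ', hR'⟩
  choose! b hb Q Q' hQ hQ' hQe hQe' using hfam
  obtain ⟨tm, htm, hmax⟩ := Set.exists_max_image _ b hTfin ⟨t0, ht0S, ht0W⟩
  refine ⟨b tm, hb tm htm, ?_⟩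
  have hsep : ∀ t : V, ∃ P : Set V, P.Finite ∧ (t ∈ (S ∪ S') ∩ W → ∀ E, Cn G E →
      E ⊆ Q t ∨ E ⊆ Q' t → Disjoint E P → ∃ β < b t, Rk G β E) := by
    intro t
    by_cases ht : t ∈ (S ∪ S') ∩ W
    · obtain ⟨P, hP, h1⟩ := rk_iff.1 (hQ t ht)
      obtain ⟨P', hP', h2⟩ := rk_iff.1 (hQ' t ht)
      refine ⟨P ∪ P', hP.union hP', fun _ E hE hEQ hEP => ?_⟩
      rcases hEQ with hEQ | hEQ
      · exact h1 E hE hEQ (hEP.mono_right Set.subset_union_left)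
      · exact h2 E hE hEQ (hEP.mono_right Set.subset_union_right)
    · exact ⟨∅, Set.finite_empty, fun hh => absurd hh ht⟩
  choose P hP hPs using hsep
  rw [rk_iff]
  refine ⟨(S ∪ S') ∪ ⋃ t ∈ (S ∪ S') ∩ W, P t,
    (h.1.union h'.1).union (hTfin.biUnion fun t _ => hP t), ?_⟩
  intro E hE hEW hEd
  rw [Set.disjoint_union_right] at hEd
  obtain ⟨e, he⟩ := hE.1
  have hEU : E ⊆ W \ (S ∪ S') := fun x hx => ⟨hEW hx, Set.disjoint_left.1 hEd.1 hx⟩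
  obtain ⟨a, ha, t, htW, htS, hat⟩ := comp_edge G hW (hEU he) ht0W ht0S
  have hbig := (comp_cn G (hEU he)).insert ha hat
  have hEbig : E ⊆ insert t (comp G (W \ (S ∪ S')) e) :=
    (comp_max G he hE hEU).trans (Set.subset_insert _ _)
  have htT : t ∈ (S ∪ S') ∩ W := ⟨htS, htW⟩
  have hres : E ⊆ Q t ∨ E ⊆ Q' t := by
    by_cases htS1 : t ∈ S
    · have htS2 : t ∉ S' := fun hh => Set.disjoint_left.1 hWd htW ⟨htS1, hh⟩
      right
      rw [hQe' t htT htS2]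
      refine hEbig.trans (comp_max G (Or.inl rfl) hbig ?_)
      rintro x (rfl | hx)
      · exact ⟨htW, htS2⟩
      · have := comp_sub G _ e hx
        exact ⟨this.1, fun hh => this.2 (Or.inr hh)⟩
    · left
      rw [hQe t htT htS1]
      refine hEbig.trans (comp_max G (Or.inl rfl) hbig ?_)
      rintro x (rfl | hx)
      · exact ⟨htW, htS1⟩
      · have := comp_sub G _ e hx
        exact ⟨this.1, fun hh => this.2 (Or.inl hh)⟩
  obtain ⟨β, hβ, hR⟩ := hPs t htT E hE hres
    (hEd.2.mono_right (Set.subset_biUnion_of_mem (u := P) htT))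
  exact ⟨β, hβ.trans_le (hmax t htT), hR⟩

/-- `K` is the kernel with respect to `α`. -/
def IsKer {V : Type u} (G : SimpleGraph V) (α : Ordinal.{u}) (K : Set V) : Prop :=
  Good G α K ∧ ∀ S, Good G α S → K ⊆ S

theorem exists_ker {V : Type u} {G : SimpleGraph V} {α : Ordinal.{u}}
    (h : Rk G α Set.univ) : ∃ K, IsKer G α K := by
  obtain ⟨S, hS, hS'⟩ := rk_iff.1 h
  have hex : ∃ n, ∃ S : Set V, Good G α S ∧ S.ncard = n :=
    ⟨_, S, ⟨hS, fun W h1 h2 => hS' W h1 (Set.subset_univ _) h2⟩, rfl⟩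
  classical
  obtain ⟨K, hK, hKn⟩ := Nat.find_spec hex
  refine ⟨K, hK, fun S hS => ?_⟩
  have h1 := Nat.find_min' hex ⟨K ∩ S, hK.inter hS, rfl⟩
  rw [← hKn] at h1
  have := Set.eq_of_subset_of_ncard_le (Set.inter_subset_left (s := K) (t := S)) h1 hK.1
  exact Set.inter_eq_left.1 this

theorem IsKer.map {V W : Type u} {G : SimpleGraph V} {H : SimpleGraph W} {f : V → W}
    (hinj : Function.Injective f)
    (hadj : ∀ x y, H.Adj (f x) (f y) ↔ G.Adj x y) {α : Ordinal.{u}} {K : Set V} {K' : Set W}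
    (hK : IsKer G α K) (hK' : IsKer H α K') : f '' K ⊆ K' := by
  rw [Set.image_subset_iff]
  refine hK.2 _ ⟨hK'.1.1.preimage hinj.injOn, ?_⟩
  intro D hD hDd
  obtain ⟨β, hβ, hR⟩ := hK'.1.2 (f '' D) (hD.image f hadj) (by
    rw [Set.disjoint_left]
    rintro _ ⟨x, hx, rfl⟩ hxS
    exact Set.disjoint_left.1 hDd hx hxS)
  exact ⟨β, hβ, hR.pullback f hinj hadj β D _ subset_rfl⟩

/-! ### Coloured graphs -/

/-- A graph with vertices coloured by `L`. -/
structure CG (L : Type u) where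
  V : Type u
  G : SimpleGraph V
  c : V → L

namespace CG

variable {L : Type u}

/-- Colour preserving induced embeddings. -/
structure Emb (A B : CG L) where
  f : A.V → B.V
  inj : Function.Injective f
  adj : ∀ x y, B.G.Adj (f x) (f y) ↔ A.G.Adj x y
  col : ∀ x, B.c (f x) = A.c x

/-- Identity. -/
def Emb.id (A : CG L) : Emb A A := ⟨fun x => x, fun _ _ h => h, fun _ _ => Iff.rfl, fun _ => rfl⟩

/-- Composition. -/
def Emb.comp {A B C : CG L} (g : Emb B C) (f : Emb A B) : Emb A C :=
  ⟨fun x => g.f (f.f x), fun _ _ h => f.inj (g.inj h),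
    fun _ _ => (g.adj _ _).trans (f.adj _ _), fun _ => (g.col _).trans (f.col _)⟩

/-- `A` embeds in `B`. -/
def Le (A B : CG L) : Prop := Nonempty (Emb A B)

/-- Mutual embeddability. -/
def Eqv (A B : CG L) : Prop := Le A B ∧ Le B A

/-- Isomorphism. -/
def Iso (A B : CG L) : Prop := ∃ f : Emb A B, Function.Surjective f.f

theorem Le.refl (A : CG L) : Le A A := ⟨Emb.id A⟩

theorem Le.trans {A B C : CG L} : Le A B → Le B C → Le A C := fun ⟨f⟩ ⟨g⟩ => ⟨g.comp f⟩

theorem Eqv.refl (A : CG L) : Eqv A A := ⟨Le.refl A, Le.refl A⟩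

theorem Eqv.symm {A B : CG L} (h : Eqv A B) : Eqv B A := ⟨h.2, h.1⟩

theorem Eqv.trans {A B C : CG L} (h : Eqv A B) (h' : Eqv B C) : Eqv A C :=
  ⟨h.1.trans h'.1, h'.2.trans h.2⟩

theorem Emb.exists_inv {A B : CG L} (f : Emb A B) (hf : Function.Surjective f.f) :
    ∃ g : Emb B A, (∀ x, g.f (f.f x) = x) ∧ (∀ y, f.f (g.f y) = y) := by
  choose g hg using hf
  refine ⟨⟨g, ?_, ?_, ?_⟩, ?_, hg⟩
  · intro x y h
    rw [← hg x, h, hg y]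
  · intro x y
    rw [← f.adj, hg, hg]
  · intro x
    rw [← f.col, hg]
  · intro x
    exact f.inj (hg _)

theorem Iso.refl (A : CG L) : Iso A A := ⟨Emb.id A, fun x => ⟨x, rfl⟩⟩

theorem Iso.symm {A B : CG L} : Iso A B → Iso B A := by
  rintro ⟨f, hf⟩
  obtain ⟨g, h1, h2⟩ := f.exists_inv hf
  exact ⟨g, fun x => ⟨_, h1 x⟩⟩

theorem Iso.trans {A B C : CG L} : Iso A B → Iso B C → Iso A C := by
  rintro ⟨f, hf⟩ ⟨g, hg⟩
  exact ⟨g.comp f, hg.comp hf⟩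

theorem Iso.eqv {A B : CG L} (h : Iso A B) : Eqv A B :=
  ⟨⟨h.choose⟩, ⟨h.symm.choose⟩⟩

/-- Connectedness. -/
def Conn (A : CG L) : Prop := Cn A.G Set.univ

/-- No two disjoint copies of `C` in `C`. -/
def NoDouble (C : CG L) : Prop := ∀ f g : Emb C C, ∃ x y, f.f x = g.f y

/-- If `C` has a connected twin then it has infinitely many. -/
def TwinsInf (C : CG L) : Prop :=
  ∀ D, Conn D → Eqv D C → ¬ Iso D C → ∃ F : ℕ → CG L,
    (∀ n, Conn (F n) ∧ Eqv (F n) C) ∧ ∀ n m, n ≠ m → ¬ Iso (F n) (F m)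

/-- Every component meets the colour set `Z`. -/
def Att (Z : Set L) (B : CG L) : Prop := ∀ v, ∃ W, Cn B.G W ∧ v ∈ W ∧ ∃ w ∈ W, B.c w ∈ Z

/-- Infinitely many equivalent graphs. -/
def InfAtt (Z : Set L) (B : CG L) : Prop := ∃ F : ℕ → CG L,
  (∀ n, Eqv (F n) B) ∧ (∀ n, Att Z (F n)) ∧ ∀ n m, n ≠ m → ¬ Iso (F n) (F m)

theorem InfAtt.congr {Z : Set L} {B B' : CG L} (h : InfAtt Z B) (hB : Eqv B B') :
    InfAtt Z B' := by
  obtain ⟨F, h1, h2, h3⟩ := h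
  exact ⟨F, fun n => (h1 n).trans hB, h2, h3⟩

/-- Disjoint unions. -/
def Uni {ι : Type u} (fam : ι → CG L) : CG L where
  V := Σ i, (fam i).V
  G :=
    { Adj := fun a b => ∃ i x y, (fam i).G.Adj x y ∧ a = ⟨i, x⟩ ∧ b = ⟨i, y⟩
      symm := ⟨by
        rintro a b ⟨i, x, y, h, ha, hb⟩
        exact ⟨i, y, x, h.symm, hb, ha⟩⟩
      loopless := ⟨by
        rintro a ⟨i, x, y, h, rfl, hb⟩
        have : x = y := by simpa using hb
        exact h.ne this⟩ }
  c := fun a => (fam a.1).c a.2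

theorem uni_adj_same {ι : Type u} {fam : ι → CG L} {i : ι} {x y : (fam i).V} :
    (Uni fam).G.Adj ⟨i, x⟩ ⟨i, y⟩ ↔ (fam i).G.Adj x y := by
  constructor
  · rintro ⟨j, a, b, h, h1, h2⟩
    obtain rfl : i = j := congrArg Sigma.fst h1
    have h1 : x = a := by simpa using h1
    have h2 : y = b := by simpa using h2
    rw [h1, h2]; exact h
  · intro h
    exact ⟨i, x, y, h, rfl, rfl⟩

theorem uni_adj_fst {ι : Type u} {fam : ι → CG L} {a b : (Uni fam).V}
    (h : (Uni fam).G.Adj a b) : a.1 = b.1 := by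
  obtain ⟨i, x, y, h, rfl, rfl⟩ := h
  rfl

theorem uni_eq {ι : Type u} {fam : ι → CG L} {i : ι} {x y : (fam i).V}
    (h : (⟨i, x⟩ : Σ i, (fam i).V) = ⟨i, y⟩) : x = y :=
  eq_of_heq (Sigma.mk.inj h).2

/-- Inclusion of a summand. -/
def incl {ι : Type u} (fam : ι → CG L) (i : ι) : Emb (fam i) (Uni fam) :=
  ⟨fun x => ⟨i, x⟩, fun _ _ h => uni_eq h, fun _ _ => uni_adj_same, fun _ => rfl⟩

/-- Embeddings from a disjoint union. -/
def desc {ι : Type u} {fam : ι → CG L} {Z : CG L} (g : ∀ i, Emb (fam i) Z)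
    (h : ∀ i j, i ≠ j → ∀ x y, (g i).f x ≠ (g j).f y ∧ ¬ Z.G.Adj ((g i).f x) ((g j).f y)) :
    Emb (Uni fam) Z where
  f := fun a => (g a.1).f a.2
  inj := by
    rintro ⟨i, x⟩ ⟨j, y⟩ hxy
    by_cases hij : i = j
    · subst hij
      exact congrArg (Sigma.mk i) ((g i).inj hxy)
    · exact absurd hxy (h i j hij x y).1
  adj := by
    rintro ⟨i, x⟩ ⟨j, y⟩
    by_cases hij : i = j
    · subst hij
      rw [uni_adj_same]
      exact (g i).adj x y
    · constructor
      · intro hh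
        exact absurd hh (h i j hij x y).2
      · intro hh
        exact absurd (uni_adj_fst hh) hij
  col := fun a => (g a.1).col a.2

theorem uni_mono {ι ι' : Type u} {fam : ι → CG L} {fam' : ι' → CG L} (m : ι → ι')
    (hm : Function.Injective m) (h : ∀ i, Le (fam i) (fam' (m i))) :
    Le (Uni fam) (Uni fam') := by
  have g : ∀ i, Emb (fam i) (fam' (m i)) := fun i => Classical.choice (h i)
  refine ⟨desc (fun i => (incl fam' (m i)).comp (g i)) ?_⟩
  intro i j hij x y
  constructor
  · intro hh
    exact hij (hm (congrArg Sigma.fst hh))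
  · intro hh
    exact hij (hm (uni_adj_fst hh))

theorem uni_iso {ι ι' : Type u} {fam : ι → CG L} {fam' : ι' → CG L} (m : ι ≃ ι')
    (h : ∀ i, Iso (fam i) (fam' (m i))) : Iso (Uni fam) (Uni fam') := by
  choose g hg using h
  refine ⟨desc (fun i => (incl fam' (m i)).comp (g i)) ?_, ?_⟩
  · intro i j hij x y
    constructor
    · intro hh
      exact hij (m.injective (congrArg Sigma.fst hh))
    · intro hh
      exact hij (m.injective (uni_adj_fst hh))
  · rintro ⟨j, y⟩
    obtain ⟨i, rfl⟩ := m.surjective j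
    obtain ⟨x, rfl⟩ := hg i y
    exact ⟨⟨i, x⟩, rfl⟩

theorem factor {ι : Type u} {fam : ι → CG L} {C : CG L} (hC : Conn C) (f : Emb C (Uni fam)) :
    ∃ j, ∃ g : Emb C (fam j), ∀ x, f.f x = ⟨j, g.f x⟩ := by
  obtain ⟨x0, -⟩ := hC.1
  have h1 : ∀ x, (f.f x).1 = (f.f x0).1 := by
    intro x
    refine hC.2 {x | (f.f x).1 = (f.f x0).1} (Set.subset_univ _) ⟨x0, rfl⟩ ?_ (Set.mem_univ x)
    intro a ha b _ hab
    have := uni_adj_fst ((f.adj a b).2 hab)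
    exact this.symm.trans ha
  have h2 : ∀ x, ∃ y, f.f x = ⟨(f.f x0).1, y⟩ := by
    intro x
    have := h1 x
    generalize f.f x = a at *
    generalize (f.f x0).1 = j at *
    subst this
    exact ⟨a.2, rfl⟩
  generalize (f.f x0).1 = j at h2
  choose g hg using h2
  refine ⟨j, ⟨g, ?_, ?_, ?_⟩, hg⟩
  · intro x y h
    apply f.inj
    rw [hg, hg, h]
  · intro x y
    rw [← f.adj, hg, hg]
    exact uni_adj_same.symm
  · intro x
    rw [← f.col, hg]
    rfl

theorem iso_index {ι ι' : Type u} {fam : ι → CG L} {fam' : ι' → CG L}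
    (hc : ∀ i, Conn (fam i)) (hc' : ∀ i, Conn (fam' i)) (h : Iso (Uni fam) (Uni fam')) :
    ∃ m : ι → ι', Function.Injective m ∧ ∀ i, Iso (fam i) (fam' (m i)) := by
  obtain ⟨f, hf⟩ := h
  obtain ⟨f', h1, h2⟩ := f.exists_inv hf
  have hfac := fun i => factor (hc i) (f.comp (incl fam i))
  have hfac' := fun i => factor (hc' i) (f'.comp (incl fam' i))
  choose m g hg using hfac
  choose m' g' hg' using hfac'
  have hg : ∀ i x, f.f ⟨i, x⟩ = ⟨m i, (g i).f x⟩ := hg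
  have hg' : ∀ i x, f'.f ⟨i, x⟩ = ⟨m' i, (g' i).f x⟩ := hg'
  have hm : ∀ i, m' (m i) = i := by
    intro i
    obtain ⟨x, -⟩ := (hc i).1
    have := h1 ⟨i, x⟩
    rw [hg, hg'] at this
    exact congrArg Sigma.fst this
  have hmi : Function.Injective m := fun i j hij => by rw [← hm i, hij, hm j]
  refine ⟨m, hmi, fun i => ⟨g i, ?_⟩⟩
  intro y
  obtain ⟨⟨i', x⟩, hx⟩ := hf ⟨m i, y⟩
  rw [hg] at hx
  obtain rfl : i' = i := hmi (congrArg Sigma.fst hx)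
  exact ⟨x, uni_eq hx⟩

theorem att_uni {ι : Type u} {fam : ι → CG L} {Z : Set L} (hc : ∀ i, Conn (fam i))
    (hz : ∀ i, ∃ v, (fam i).c v ∈ Z) : Att Z (Uni fam) := by
  rintro ⟨i, x⟩
  obtain ⟨v, hv⟩ := hz i
  exact ⟨(incl fam i).f '' Set.univ, (hc i).image _ (incl fam i).adj, ⟨x, trivial, rfl⟩,
    ⟨i, v⟩, ⟨v, trivial, rfl⟩, hv⟩

/-- Induced subgraphs. -/
def ind (B : CG L) (W : Set B.V) : CG L where
  V := W
  G := B.G.induce W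
  c := fun v => B.c v.1

/-- Inclusion of an induced subgraph. -/
def indEmb (B : CG L) (W : Set B.V) : Emb (ind B W) B :=
  ⟨fun x => x.1, Subtype.val_injective, fun _ _ => Iff.rfl, fun _ => rfl⟩

theorem ind_conn {B : CG L} {W : Set B.V} (h : Cn B.G W) : Conn (ind B W) := by
  refine Cn.of_image (indEmb B W).f (indEmb B W).inj (indEmb B W).adj (U := Set.univ) ?_
  have : (indEmb B W).f '' Set.univ = W := by
    ext x
    constructor
    · rintro ⟨y, -, rfl⟩
      exact y.2
    · intro hx
      exact ⟨⟨x, hx⟩, trivial, rfl⟩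
  rw [this]
  exact h

theorem exists_fam (B : CG L) : ∃ (ι : Type u) (fam : ι → CG L), (∀ i, Conn (fam i)) ∧
    Iso (Uni fam) B ∧ ∀ Z, Att Z B → ∀ i, ∃ v, (fam i).c v ∈ Z := by
  let ι := {W : Set B.V // ∃ e, W = comp B.G Set.univ e}
  let fam : ι → CG L := fun W => ind B W.1
  have huniq : ∀ (W : ι) x, x ∈ W.1 → W.1 = comp B.G Set.univ x := by
    rintro ⟨W, e, rfl⟩ x hx
    exact (comp_eq B.G (Set.mem_univ _) hx).symm
  have hcn : ∀ W : ι, Cn B.G W.1 := by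
    rintro ⟨W, e, rfl⟩
    exact comp_cn B.G trivial
  refine ⟨ι, fam, fun W => ind_conn (hcn W), ⟨desc (fun W => indEmb B W.1) ?_, ?_⟩, ?_⟩
  · intro W W' hne x y
    constructor
    · intro hh
      apply hne
      apply Subtype.ext
      rw [huniq W x.1 x.2, huniq W' y.1 y.2]
      exact congrArg _ hh
    · intro hh
      apply hne
      apply Subtype.ext
      have hy : y.1 ∈ W.1 := by
        rw [huniq W x.1 x.2]
        exact comp_adj B.G trivial (mem_comp B.G trivial) trivial hh
      exact (huniq W y.1 hy).trans (huniq W' y.1 y.2).symm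
  · intro x
    exact ⟨⟨⟨comp B.G Set.univ x, x, rfl⟩, ⟨x, mem_comp B.G trivial⟩⟩, rfl⟩
  · intro Z hZ W
    obtain ⟨x, hx⟩ := (hcn W).1
    obtain ⟨D, hD, hxD, w, hw, hwZ⟩ := hZ x
    refine ⟨⟨w, ?_⟩, hwZ⟩
    rw [huniq W x hx]
    exact comp_max B.G hxD hD (Set.subset_univ _) hw

theorem caseOne {ι : Type u} {fam : ι → CG L} {Z : Set L} (hc : ∀ i, Conn (fam i))
    (hz : ∀ i, ∃ v, (fam i).c v ∈ Z) (i0 : ι) (hT : TwinsInf (fam i0)) (D : CG L)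
    (hD : Conn D) (hDe : Eqv D (fam i0)) (hDi : ¬ Iso D (fam i0)) : InfAtt Z (Uni fam) := by
  classical
  obtain ⟨F, hF, hFn⟩ := hT D hD hDe hDi
  let fm : ℕ → ι → CG L := fun n i => if Eqv (fam i) (fam i0) then F n else fam i
  have hfe : ∀ n i, Eqv (fm n i) (fam i) := by
    intro n i
    by_cases h : Eqv (fam i) (fam i0)
    · simp only [fm, if_pos h]
      exact (hF n).2.trans h.symm
    · simp only [fm, if_neg h]
      exact Eqv.refl _
  have hfc : ∀ n i, Conn (fm n i) := by
    intro n i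
    by_cases h : Eqv (fam i) (fam i0)
    · simp only [fm, if_pos h]
      exact (hF n).1
    · simp only [fm, if_neg h]
      exact hc i
  refine ⟨fun n => Uni (fm n), ?_, ?_, ?_⟩
  · intro n
    exact ⟨uni_mono id Function.injective_id (fun i => (hfe n i).1),
      uni_mono id Function.injective_id (fun i => (hfe n i).2)⟩
  · intro n
    refine att_uni (hfc n) ?_
    intro i
    obtain ⟨v, hv⟩ := hz i
    obtain ⟨g⟩ := (hfe n i).2
    refine ⟨g.f v, ?_⟩
    rw [g.col]
    exact hv
  · intro n m hnm hiso
    obtain ⟨e, -, he⟩ := iso_index (hfc n) (hfc m) hiso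
    have h1 : fm n i0 = F n := if_pos (Eqv.refl _)
    have h2 := he i0
    rw [h1] at h2
    have h3 : Eqv (fam (e i0)) (fam i0) :=
      ((hfe m _).symm.trans h2.symm.eqv).trans (hF n).2
    have h4 : fm m (e i0) = F m := if_pos h3
    rw [h4] at h2
    exact hFn n m hnm h2

/-- The union with the components in `A` replaced by `J` copies of `T`. -/
def HJ {ι : Type u} (fam : ι → CG L) (A : Set ι) (T : CG L) (J : Type u) : CG L :=
  Uni (Sum.elim (fun j : {j // j ∉ A} => fam j.1) (fun _ : J => T))

/-- Vertices outside `A`. -/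
def rho {ι : Type u} (fam : ι → CG L) (A : Set ι) (T : CG L) (J : Type u)
    (v : (Uni fam).V) (hv : v.1 ∉ A) : (HJ fam A T J).V := ⟨Sum.inl ⟨v.1, hv⟩, v.2⟩

theorem rho_inj {ι : Type u} {fam : ι → CG L} {A : Set ι} {T : CG L} {J : Type u}
    {v w : (Uni fam).V} {hv : v.1 ∉ A} {hw : w.1 ∉ A}
    (h : rho fam A T J v hv = rho fam A T J w hw) : v = w := by
  obtain ⟨i, x⟩ := v
  obtain ⟨j, y⟩ := w
  have h1 := congrArg Sigma.fst h
  obtain rfl : i = j := by simpa [rho] using h1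
  exact congrArg (Sigma.mk i) (eq_of_heq (Sigma.mk.inj h).2)

theorem rho_adj {ι : Type u} {fam : ι → CG L} {A : Set ι} {T : CG L} {J : Type u}
    {v w : (Uni fam).V} {hv : v.1 ∉ A} {hw : w.1 ∉ A}
    (h : (HJ fam A T J).G.Adj (rho fam A T J v hv) (rho fam A T J w hw)) :
    (Uni fam).G.Adj v w := by
  obtain ⟨i, x⟩ := v
  obtain ⟨j, y⟩ := w
  have h1 := uni_adj_fst h
  obtain rfl : i = j := by simpa [rho] using h1
  have h2 := (uni_adj_same (fam := Sum.elim (fun j : {j // j ∉ A} => fam j.1)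
    (fun _ : J => T)) (i := Sum.inl ⟨i, hv⟩) (x := x) (y := y)).1 h
  exact uni_adj_same.2 h2

theorem pump {ι : Type u} {fam : ι → CG L} {A S U : Set ι} {T : CG L}
    (hUA : ∀ j ∈ U, j ∉ A) (hSA : S ⊆ A) (F : Emb (Uni fam) (Uni fam)) (m : ι → ι)
    (Fe : ∀ j, Emb (fam j) (fam (m j))) (hF : ∀ j x, F.f ⟨j, x⟩ = ⟨m j, (Fe j).f x⟩)
    (hU : ∀ j ∈ U, m j ∈ U) (hS : ∀ j ∈ S, m j ∈ U) (hT : ∀ j ∈ S, Le T (fam j))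
    {J J' : Type u} (e : J' ↪ J ⊕ S) : Le (HJ fam A T J') (HJ fam A T J) := by
  classical
  let fJ := Sum.elim (fun j : {j // j ∉ A} => fam j.1) (fun _ : J => T)
  let Spec : ∀ (C : CG L), ({j // j ∉ A} ⊕ J) ⊕ ι → Emb C (Uni fJ) → Prop := fun C o g =>
    (∃ t, o = Sum.inl t ∧ (∀ u (hu : u ∉ A), u ∈ U → t ≠ Sum.inl ⟨u, hu⟩) ∧
      ∀ x, (g.f x).1 = t) ∨
    (∃ s, o = Sum.inr s ∧ ∀ x, ∃ y, ∃ h : (F.f ⟨s, y⟩).1 ∉ A, (F.f ⟨s, y⟩).1 ∈ U ∧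
      g.f x = rho fam A T J (F.f ⟨s, y⟩) h)
  have disj : ∀ C C' o o' g g', Spec C o g → Spec C' o' g' → o ≠ o' → ∀ x y,
      g.f x ≠ g'.f y ∧ ¬ (Uni fJ).G.Adj (g.f x) (g'.f y) := by
    rintro C C' o o' g g' (⟨t, rfl, h1, h2⟩ | ⟨s, rfl, h⟩) (⟨t', rfl, h1', h2'⟩ | ⟨s', rfl, h'⟩)
      hne x y
    · constructor
      · intro hh
        apply hne
        rw [← h2 x, ← h2' y, hh]
      · intro hh
        apply hne
        rw [← h2 x, ← h2' y, uni_adj_fst hh]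
    · obtain ⟨z, hz, hzU, hgz⟩ := h' y
      constructor
      · intro hh
        apply h1 _ hz hzU
        rw [← h2 x, hh, hgz]
        rfl
      · intro hh
        apply h1 _ hz hzU
        rw [← h2 x, uni_adj_fst hh, hgz]
        rfl
    · obtain ⟨z, hz, hzU, hgz⟩ := h x
      constructor
      · intro hh
        apply h1' _ hz hzU
        rw [← h2' y, ← hh, hgz]
        rfl
      · intro hh
        apply h1' _ hz hzU
        rw [← h2' y, ← uni_adj_fst hh, hgz]
        rfl
    · obtain ⟨z, hz, hzU, hgz⟩ := h x
      obtain ⟨z', hz', hzU', hgz'⟩ := h' y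
      rw [hgz, hgz']
      constructor
      · intro hh
        apply hne
        have := F.inj (rho_inj hh)
        exact congrArg Sum.inr (congrArg Sigma.fst this)
      · intro hh
        apply hne
        have := (F.adj _ _).1 (rho_adj hh)
        exact congrArg Sum.inr (uni_adj_fst this)
  let targ : {j // j ∉ A} ⊕ J' → ({j // j ∉ A} ⊕ J) ⊕ ι := fun k => match k with
    | Sum.inl j => if j.1 ∈ U then Sum.inr j.1 else Sum.inl (Sum.inl j)
    | Sum.inr i => match e i with
      | Sum.inl j => Sum.inl (Sum.inr j)
      | Sum.inr s => Sum.inr s.1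
  have htarg : Function.Injective targ := by
    rintro (j | i) (j' | i') h
    · by_cases h1 : j.1 ∈ U <;> by_cases h2 : j'.1 ∈ U
      · simp only [targ, if_pos h1, if_pos h2, Sum.inr.injEq] at h
        rw [Subtype.ext h]
      · simp [targ, if_pos h1, if_neg h2] at h
      · simp [targ, if_neg h1, if_pos h2] at h
      · simp only [targ, if_neg h1, if_neg h2, Sum.inl.injEq] at h
        rw [h]
    · exfalso
      by_cases h1 : j.1 ∈ U <;> rcases he : e i' with j'' | s
      · simp [targ, if_pos h1, he] at h
      · simp only [targ, if_pos h1, he, Sum.inr.injEq] at h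
        exact hUA _ h1 (h ▸ hSA s.2)
      · simp [targ, if_neg h1, he] at h
      · simp [targ, if_neg h1, he] at h
    · exfalso
      by_cases h1 : j'.1 ∈ U <;> rcases he : e i with j'' | s
      · simp [targ, if_pos h1, he] at h
      · simp only [targ, if_pos h1, he, Sum.inr.injEq] at h
        exact hUA _ h1 (h ▸ hSA s.2)
      · simp [targ, if_neg h1, he] at h
      · simp [targ, if_neg h1, he] at h
    · rcases he : e i with j | s <;> rcases he' : e i' with j' | s'
      · simp only [targ, he, he', Sum.inl.injEq, Sum.inr.injEq] at h
        rw [e.injective (he.trans (h ▸ he'.symm))]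
      · simp [targ, he, he'] at h
      · simp [targ, he, he'] at h
      · simp only [targ, he, he', Sum.inr.injEq] at h
        have h := Subtype.ext h
        rw [e.injective (he.trans (h ▸ he'.symm))]
  have hex : ∀ k, ∃ g : Emb (Sum.elim (fun j : {j // j ∉ A} => fam j.1) (fun _ : J' => T) k)
      (Uni fJ), Spec _ (targ k) g := by
    rintro (j | i)
    · by_cases h1 : j.1 ∈ U
      · have hm := hUA _ (hU _ h1)
        refine ⟨(incl fJ (Sum.inl ⟨m j.1, hm⟩)).comp (Fe j.1), Or.inr ⟨j.1, ?_, ?_⟩⟩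
        · simp [targ, if_pos h1]
        · intro x
          change (fam j.1).V at x
          refine ⟨x, ?_, ?_, ?_⟩
          · rw [hF]; exact hm
          · rw [hF]; exact hU _ h1
          · simp only [hF]
            rfl
      · refine ⟨incl fJ (Sum.inl j), Or.inl ⟨Sum.inl j, ?_, ?_, ?_⟩⟩
        · simp [targ, if_neg h1]
        · intro u hu huU hh
          have := Sum.inl.inj hh
          rw [this] at h1
          exact h1 huU
        · intro x
          rfl
    · rcases he : e i with j | s
      · refine ⟨incl fJ (Sum.inr j), Or.inl ⟨Sum.inr j, ?_, ?_, ?_⟩⟩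
        · simp [targ, he]
        · intro u hu huU hh
          cases hh
        · intro x
          rfl
      · have hm := hUA _ (hS _ s.2)
        obtain ⟨g⟩ := hT s.1 s.2
        refine ⟨(incl fJ (Sum.inl ⟨m s.1, hm⟩)).comp ((Fe s.1).comp g),
          Or.inr ⟨s.1, ?_, ?_⟩⟩
        · simp [targ, he]
        · intro x
          refine ⟨g.f x, ?_, ?_, ?_⟩
          · rw [hF]; exact hm
          · rw [hF]; exact hS _ s.2
          · simp only [hF]
            rfl
  choose g hg using hex
  exact ⟨desc g fun i j hij => disj _ _ _ _ _ _ (hg i) (hg j) (fun h => hij (htarg h))⟩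

theorem caseTwo {ι ι' : Type u} {fam : ι → CG L} {fam' : ι' → CG L} {Z : Set L}
    (hc : ∀ i, Conn (fam i)) (hc' : ∀ i, Conn (fam' i))
    (hz' : ∀ i, ∃ v, (fam' i).c v ∈ Z)
    (he : Eqv (Uni fam) (Uni fam')) (T : CG L) (hT : Conn T) (hTZ : ∃ v, T.c v ∈ Z)
    (hTd : NoDouble T) (hTr : ∀ D, Conn D → Eqv D T → Iso D T)
    (hlt : Cardinal.mk {i // Iso (fam i) T} < Cardinal.mk {j // Iso (fam' j) T}) :
    InfAtt Z (Uni fam') := by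
  classical
  obtain ⟨⟨φ⟩, ⟨ψ⟩⟩ := he
  have hψ := fun j => factor (hc' j) (ψ.comp (incl fam' j))
  choose p pe hp using hψ
  have hp : ∀ j x, ψ.f ⟨j, x⟩ = ⟨p j, (pe j).f x⟩ := hp
  have hφ := fun j => factor (hc j) (φ.comp (incl fam j))
  choose q qe hq using hφ
  have hq : ∀ j x, φ.f ⟨j, x⟩ = ⟨q j, (qe j).f x⟩ := hq
  let A : Set ι' := {j | Iso (fam' j) T}
  let S : Set ι' := {j | Iso (fam' j) T ∧ ¬ Iso (fam (p j)) T}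
  let m : ι' → ι' := fun j => q (p j)
  let Fe : ∀ j, Emb (fam' j) (fam' (m j)) := fun j => (qe (p j)).comp (pe j)
  have hF : ∀ j x, (φ.comp ψ).f ⟨j, x⟩ = ⟨m j, (Fe j).f x⟩ := by
    intro j x
    show φ.f (ψ.f ⟨j, x⟩) = _
    rw [hp, hq]
    rfl
  let U : Set ι' := {k | ∃ j ∈ S, Le (fam (p j)) (fam' k)}
  have hUA : ∀ k ∈ U, k ∉ A := by
    rintro k ⟨j, ⟨hj1, hj2⟩, hjk⟩ hk
    apply hj2
    apply hTr _ (hc _)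
    exact ⟨hjk.trans (Iso.eqv hk).1, hj1.eqv.2.trans ⟨pe j⟩⟩
  have hUm : ∀ k ∈ U, m k ∈ U := by
    rintro k ⟨j, hj, hjk⟩
    exact ⟨j, hj, hjk.trans ⟨Fe k⟩⟩
  have hSm : ∀ k ∈ S, m k ∈ U := fun k hk => ⟨k, hk, ⟨qe (p k)⟩⟩
  have hSA : S ⊆ A := fun k hk => hk.1
  have hpump : ∀ {J J' : Type u}, (J' ↪ J ⊕ S) → Le (HJ fam' A T J') (HJ fam' A T J) :=
    fun e => pump hUA hSA (φ.comp ψ) m Fe hF hUm hSm (fun j hj => hj.1.eqv.2) e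
  -- counting
  have hinj : Function.Injective (fun j : (A \ S : Set ι') =>
      (⟨p j.1, by
        by_contra hh
        exact j.2.2 ⟨j.2.1, hh⟩⟩ : {i // Iso (fam i) T})) := by
    rintro ⟨j, hjA, hjS⟩ ⟨j', hjA', hjS'⟩ h
    have h : p j = p j' := by simpa using h
    by_contra hne
    have hne : j ≠ j' := fun hh => hne (Subtype.ext hh)
    have hpT : Iso (fam (p j)) T := by
      by_contra hh
      exact hjS ⟨hjA, hh⟩
    obtain ⟨a⟩ := hpT.eqv.1
    obtain ⟨b⟩ := (Iso.eqv hjA).2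
    obtain ⟨b'⟩ := (Iso.eqv hjA').2
    have key : ∃ g : Emb (fam' j') (fam (p j)), ∀ x, ψ.f ⟨j', x⟩ = ⟨p j, g.f x⟩ := by
      rw [h]
      exact ⟨pe j', hp j'⟩
    obtain ⟨g, hg⟩ := key
    obtain ⟨x, y, hxy⟩ := hTd (a.comp ((pe j).comp b)) (a.comp (g.comp b'))
    have h1 : (pe j).f (b.f x) = g.f (b'.f y) := a.inj hxy
    have h2 : ψ.f ⟨j, b.f x⟩ = ψ.f ⟨j', b'.f y⟩ := by
      rw [hp, hg, h1]
    exact hne (congrArg Sigma.fst (ψ.inj h2))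
  have hcard1 : Cardinal.mk (A \ S : Set ι') < Cardinal.mk A :=
    (Cardinal.mk_le_of_injective hinj).trans_lt hlt
  have hBA : Iso (Uni fam') (HJ fam' A T A) := by
    refine (uni_iso (fam' := fam') ((Equiv.sumComm _ _).trans (Equiv.Set.sumCompl A)) ?_).symm
    rintro (j | j)
    · exact Iso.refl _
    · exact Iso.symm j.2
  have hconn : ∀ (J : Type u) k, Conn
      (Sum.elim (fun j : {j // j ∉ A} => fam' j.1) (fun _ : J => T) k) := by
    rintro J (j | j)
    · exact hc' _
    · exact hT
  have hatt : ∀ J : Type u, Att Z (HJ fam' A T J) := by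
    intro J
    refine att_uni (hconn J) ?_
    rintro (j | j)
    · exact hz' _
    · exact hTZ
  have hcnt : ∀ J J' : Type u, Iso (HJ fam' A T J) (HJ fam' A T J') → Nonempty (J ↪ J') := by
    intro J J' h
    obtain ⟨e, he, hiso⟩ := iso_index (hconn J) (hconn J') h
    have : ∀ j : J, ∃ j', e (Sum.inr j) = Sum.inr j' := by
      intro j
      have h1 := hiso (Sum.inr j)
      rcases he' : e (Sum.inr j) with k | k
      · exfalso
        rw [he'] at h1
        exact k.2 h1.symm
      · exact ⟨k, rfl⟩
    choose g hg using this
    refine ⟨⟨g, fun a b hab => ?_⟩⟩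
    have : e (Sum.inr a) = e (Sum.inr b) := by rw [hg, hg, hab]
    exact Sum.inr.inj (he this)
  have hfincnt : ∀ a b : ℕ, Iso (HJ fam' A T (ULift.{u} (Fin a)))
      (HJ fam' A T (ULift.{u} (Fin b))) → a = b := by
    have : ∀ a b : ℕ, Iso (HJ fam' A T (ULift.{u} (Fin a)))
      (HJ fam' A T (ULift.{u} (Fin b))) → a ≤ b := by
      intro a b h
      obtain ⟨e⟩ := hcnt _ _ h
      have := Fintype.card_le_of_embedding e
      simpa using this
    exact fun a b h => le_antisymm (this a b h) (this b a h.symm)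
  rcases finite_or_infinite A with hfin | hinf
  · -- finite multiplicity
    have hSne : Nonempty S := by
      by_contra hh
      rw [not_nonempty_iff] at hh
      have : A \ S = A := by
        rw [Set.isEmpty_coe_sort.1 hh, Set.sdiff_empty]
      rw [this] at hcard1
      exact lt_irrefl _ hcard1
    obtain ⟨s⟩ := hSne
    let N := Nat.card A
    have eA : A ≃ ULift.{u} (Fin N) := (Finite.equivFin A).trans Equiv.ulift.symm
    have hle : ∀ n, Le (HJ fam' A T (ULift.{u} (Fin (N + n)))) (HJ fam' A T A) := by
      intro n
      induction n with
      | zero => exact hpump (eA.symm.toEmbedding.trans ⟨Sum.inl, Sum.inl_injective⟩)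
      | succ n ih =>
        refine Le.trans (hpump ?_) ih
        refine ⟨fun k => if h : k.down.1 < N + n then Sum.inl ⟨⟨k.down.1, h⟩⟩ else Sum.inr s, ?_⟩
        rintro ⟨⟨a, ha⟩⟩ ⟨⟨b, hb⟩⟩ h
        by_cases h1 : a < N + n <;> by_cases h2 : b < N + n
        · simpa [h1, h2] using h
        · simp [h1, h2] at h
        · simp [h1, h2] at h
        · have : a = b := by omega
          subst this
          rfl
    refine ⟨fun n => HJ fam' A T (ULift.{u} (Fin (N + n))), ?_, fun n => hatt _, ?_⟩
    · intro n
      refine Eqv.trans ⟨hle n, ?_⟩ hBA.symm.eqv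
      refine hpump ⟨fun a => Sum.inl ⟨Fin.castLE (Nat.le_add_right N n) (eA a).down⟩, ?_⟩
      intro a b h
      have h : (eA a).down = (eA b).down := by simpa using h
      exact eA.injective (ULift.ext _ _ h)
    · intro n n' hne h
      have := hfincnt _ _ h
      omega
  · -- infinite multiplicity
    have hAS : Nonempty (A ↪ S) := by
      rw [← Cardinal.le_def]
      by_contra hh
      rw [not_le] at hh
      have hinf' : Cardinal.aleph0 ≤ Cardinal.mk A := Cardinal.infinite_iff.1 hinf
      have h1 : Cardinal.mk A ≤ Cardinal.mk (A \ S : Set ι') + Cardinal.mk S := by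
        have h2 : A ⊆ (A \ S) ∪ S := fun x hx => by
          by_cases hxS : x ∈ S
          · exact Or.inr hxS
          · exact Or.inl ⟨hx, hxS⟩
        exact (Cardinal.mk_le_mk_of_subset h2).trans (Cardinal.mk_union_le _ _)
      exact absurd h1 (not_le.2 (Cardinal.add_lt_of_lt hinf' hcard1 hh))
    obtain ⟨eS⟩ := hAS
    have h0 : Le (HJ fam' A T A) (HJ fam' A T PEmpty.{u + 1}) :=
      hpump (eS.trans ⟨Sum.inr, Sum.inr_injective⟩)
    refine ⟨fun n => HJ fam' A T (ULift.{u} (Fin n)), ?_, fun n => hatt _, ?_⟩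
    · intro n
      refine Eqv.trans ⟨?_, h0.trans ?_⟩ hBA.symm.eqv
      · have eN : ℕ ↪ A := Infinite.natEmbedding A
        refine hpump ⟨fun a => Sum.inl (eN a.down.1), ?_⟩
        intro a b h
        have h : a.down.1 = b.down.1 := eN.injective (Sum.inl.inj h)
        exact ULift.ext _ _ (Fin.ext h)
      · exact hpump ⟨fun a => a.elim, fun a => a.elim⟩
    · intro n n' hne h
      exact hne (hfincnt _ _ h)

theorem theoremB0 {ι ι' : Type u} {fam : ι → CG L} {fam' : ι' → CG L} {Z : Set L}
    (hc : ∀ i, Conn (fam i)) (hc' : ∀ i, Conn (fam' i))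
    (hz : ∀ i, ∃ v, (fam i).c v ∈ Z) (hz' : ∀ i, ∃ v, (fam' i).c v ∈ Z)
    (he : Eqv (Uni fam) (Uni fam')) (hne : ¬ Iso (Uni fam) (Uni fam'))
    (hP : ∀ i, TwinsInf (fam i) ∧ NoDouble (fam i))
    (hP' : ∀ i, TwinsInf (fam' i) ∧ NoDouble (fam' i)) : InfAtt Z (Uni fam) := by
  by_cases h1 : ∃ i D, Conn D ∧ Eqv D (fam i) ∧ ¬ Iso D (fam i)
  · obtain ⟨i, D, hD, hDe, hDi⟩ := h1
    exact caseOne hc hz i (hP i).1 D hD hDe hDi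
  by_cases h2 : ∃ i D, Conn D ∧ Eqv D (fam' i) ∧ ¬ Iso D (fam' i)
  · obtain ⟨i, D, hD, hDe, hDi⟩ := h2
    exact (caseOne hc' hz' i (hP' i).1 D hD hDe hDi).congr he.symm
  push Not at h1 h2
  by_contra hcon
  apply hne
  have hcard : ∀ T : CG L,
      Cardinal.mk {i // Iso (fam i) T} = Cardinal.mk {j // Iso (fam' j) T} := by
    intro T
    rcases lt_trichotomy (Cardinal.mk {i // Iso (fam i) T})
      (Cardinal.mk {j // Iso (fam' j) T}) with hlt | heq | hgt
    · exfalso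
      have hn : Nonempty {j // Iso (fam' j) T} := by
        rw [← Cardinal.mk_ne_zero_iff]
        exact (zero_le.trans_lt hlt).ne'
      obtain ⟨⟨j, hj⟩⟩ := hn
      have hr : ∀ C : CG L, Iso C T ↔ Iso C (fam' j) :=
        fun C => ⟨fun h => h.trans hj.symm, fun h => h.trans hj⟩
      simp only [hr] at hlt
      exact hcon ((caseTwo hc hc' hz' he (fam' j) (hc' j) (hz' j) (hP' j).2 (h2 j) hlt).congr
        he.symm)
    · exact heq
    · exfalso
      have hn : Nonempty {j // Iso (fam j) T} := by
        rw [← Cardinal.mk_ne_zero_iff]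
        exact (zero_le.trans_lt hgt).ne'
      obtain ⟨⟨j, hj⟩⟩ := hn
      have hr : ∀ C : CG L, Iso C T ↔ Iso C (fam j) :=
        fun C => ⟨fun h => h.trans hj.symm, fun h => h.trans hj⟩
      simp only [hr] at hgt
      exact hcon (caseTwo hc' hc hz he.symm (fam j) (hc j) (hz j) (hP j).2 (h1 j) hgt)
  let st : Setoid (CG L) := ⟨Iso, Iso.refl, Iso.symm, Iso.trans⟩
  have key : ∀ c : Quotient st, Nonempty ({i // (Quotient.mk st (fam i)) = c} ≃
      {j // (Quotient.mk st (fam' j)) = c}) := by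
    intro c
    induction c using Quotient.inductionOn with
    | h T =>
      have h3 := Cardinal.eq.1 (hcard T)
      have hr : ∀ C : CG L, Quotient.mk st C = Quotient.mk st T ↔ Iso C T :=
        fun C => Quotient.eq
      simp only [hr]
      exact h3
  let m : ι ≃ ι' := Equiv.ofFiberEquiv (fun c => Classical.choice (key c))
  refine uni_iso m ?_
  intro i
  have := Equiv.ofFiberEquiv_map (fun c => Classical.choice (key c)) i
  exact Iso.symm (Quotient.exact this)

theorem theoremB {B B' : CG L} {Z : Set L} (hz : Att Z B) (hz' : Att Z B')
    (he : Eqv B B') (hne : ¬ Iso B B')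
    (hP : ∀ C, Conn C → Le C B → TwinsInf C ∧ NoDouble C) : InfAtt Z B := by
  obtain ⟨ι, fam, hc, hi, ha⟩ := exists_fam B
  obtain ⟨ι', fam', hc', hi', ha'⟩ := exists_fam B'
  refine (theoremB0 hc hc' (ha Z hz) (ha' Z hz') ((hi.eqv.trans he).trans hi'.symm.eqv)
    (fun h => hne ((hi.symm.trans h).trans hi')) ?_ ?_).congr hi.eqv
  · intro i
    exact hP _ (hc i) (Le.trans ⟨incl fam i⟩ hi.eqv.1)
  · intro i
    exact hP _ (hc' i) ((Le.trans ⟨incl fam' i⟩ hi'.eqv.1).trans he.2)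

/-! ### Gluing along a finite set -/

/-- Glue `A` to `B`, where the colours of `B` record the neighbourhoods in `A`. -/
def Asm (A : CG L) (B : CG (L × Set A.V)) : CG L where
  V := A.V ⊕ B.V
  G :=
    { Adj := fun a b => match a, b with
        | Sum.inl a, Sum.inl b => A.G.Adj a b
        | Sum.inl a, Sum.inr v => a ∈ (B.c v).2
        | Sum.inr v, Sum.inl a => a ∈ (B.c v).2
        | Sum.inr v, Sum.inr w => B.G.Adj v w
      symm := ⟨by
        rintro (a | a) (b | b) h
        · exact SimpleGraph.Adj.symm h
        · exact h
        · exact h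
        · exact SimpleGraph.Adj.symm h⟩
      loopless := ⟨by
        rintro (a | a) h
        · exact SimpleGraph.Adj.ne h rfl
        · exact SimpleGraph.Adj.ne h rfl⟩ }
  c := fun v => match v with
    | Sum.inl a => A.c a
    | Sum.inr v => (B.c v).1

/-- The copy of `A` in the glued graph. -/
def core (A : CG L) (B : CG (L × Set A.V)) : Set (Asm A B).V := Set.range Sum.inl

/-- Functoriality of gluing. -/
def asmMap {A : CG L} {B B' : CG (L × Set A.V)} (e : Emb B B') : Emb (Asm A B) (Asm A B') where
  f := Sum.map (fun a => a) e.f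
  inj := Function.Injective.sumMap (fun _ _ h => h) e.inj
  adj := by
    rintro (a | a) (b | b)
    · exact Iff.rfl
    · show a ∈ (B'.c (e.f b)).2 ↔ a ∈ (B.c b).2
      rw [e.col]
    · show b ∈ (B'.c (e.f a)).2 ↔ b ∈ (B.c a).2
      rw [e.col]
    · exact e.adj a b
  col := by
    rintro (a | a)
    · rfl
    · show (B'.c (e.f a)).1 = (B.c a).1
      rw [e.col]

theorem asmMap_surj {A : CG L} {B B' : CG (L × Set A.V)} (e : Emb B B')
    (he : Function.Surjective e.f) : Function.Surjective (asmMap e).f := by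
  rintro (a | a)
  · exact ⟨Sum.inl a, rfl⟩
  · obtain ⟨b, rfl⟩ := he a
    exact ⟨Sum.inr b, rfl⟩

theorem asm_restrict {A : CG L} {B B' : CG (L × Set A.V)} (d : Emb (Asm A B) (Asm A B'))
    (hd : ∀ a, d.f (Sum.inl a) = Sum.inl a) (hs : Function.Surjective d.f) : Iso B B' := by
  have h1 : ∀ v : B.V, ∃ w : B'.V, d.f (Sum.inr v) = Sum.inr w := by
    intro v
    rcases h : d.f (Sum.inr v) with a | w
    · exfalso
      have := d.inj (h.trans (hd a).symm)
      cases this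
    · exact ⟨w, rfl⟩
  choose g hg using h1
  refine ⟨⟨g, ?_, ?_, ?_⟩, ?_⟩
  · intro x y h
    have : d.f (Sum.inr x) = d.f (Sum.inr y) := by rw [hg, hg, h]
    exact Sum.inr.inj (d.inj this)
  · intro x y
    have := d.adj (Sum.inr x) (Sum.inr y)
    rw [hg, hg] at this
    exact this
  · intro x
    apply Prod.ext
    · have := d.col (Sum.inr x)
      rw [hg] at this
      exact this
    · ext a
      have := d.adj (Sum.inr x) (Sum.inl a)
      rw [hg, hd] at this
      exact this
  · intro w
    obtain ⟨a | v, hv⟩ := hs (Sum.inr w)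
    · rw [hd] at hv
      cases hv
    · rw [hg] at hv
      exact ⟨v, Sum.inr.inj hv⟩

/-- The graph outside the copy of `A`. -/
def Rest {A : CG L} (G : CG L) (k : Emb A G) : CG (L × Set A.V) where
  V := {v : G.V // v ∉ Set.range k.f}
  G := G.G.induce {v | v ∉ Set.range k.f}
  c := fun v => (G.c v.1, {a | G.G.Adj v.1 (k.f a)})

theorem asm_rest {A : CG L} (G : CG L) (k : Emb A G) : ∃ f : Emb (Asm A (Rest G k)) G,
    Function.Surjective f.f ∧ ∀ a, f.f (Sum.inl a) = k.f a := by
  refine ⟨⟨Sum.elim k.f (fun v : {v : G.V // v ∉ Set.range k.f} => v.1), ?_, ?_, ?_⟩, ?_,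
    fun a => rfl⟩
  · rintro (a | a) (b | b) h
    · exact congrArg Sum.inl (k.inj h)
    · exact absurd ⟨a, h⟩ b.2
    · exact absurd ⟨b, Eq.symm h⟩ a.2
    · exact congrArg Sum.inr (Subtype.ext h)
  · rintro (a | a) (b | b)
    · exact k.adj a b
    · exact G.G.adj_comm _ _
    · exact Iff.rfl
    · exact Iff.rfl
  · rintro (a | a)
    · exact k.col a
    · rfl
  · intro v
    by_cases hv : v ∈ Set.range k.f
    · obtain ⟨a, rfl⟩ := hv
      exact ⟨Sum.inl a, rfl⟩
    · exact ⟨Sum.inr ⟨v, hv⟩, rfl⟩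

theorem rest_map {A G H : CG L} {k : Emb A G} {k' : Emb A H} (φ : Emb G H)
    (h : ∀ a, φ.f (k.f a) = k'.f a) : Le (Rest G k) (Rest H k') := by
  refine ⟨⟨fun v => ⟨φ.f v.1, ?_⟩, ?_, ?_, ?_⟩⟩
  · rintro ⟨a, ha⟩
    rw [← h] at ha
    exact v.2 ⟨a, φ.inj ha⟩
  · intro x y hxy
    exact Subtype.ext (φ.inj (congrArg Subtype.val hxy))
  · intro x y
    exact φ.adj x.1 y.1
  · intro x
    apply Prod.ext
    · exact φ.col x.1
    · ext a
      show H.G.Adj (φ.f x.1) (k'.f a) ↔ G.G.Adj x.1 (k.f a)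
      rw [← h, φ.adj]

/-- Isomorphism of pairs of coloured graphs. -/
def PIso (G : CG L) (K : Set G.V) (H : CG L) (K' : Set H.V) : Prop :=
  ∃ f : Emb G H, Function.Surjective f.f ∧ f.f '' K = K'

theorem PIso.refl (G : CG L) (K : Set G.V) : PIso G K G K :=
  ⟨Emb.id G, fun x => ⟨x, rfl⟩, Set.image_id' K⟩

theorem PIso.symm {G H : CG L} {K : Set G.V} {K' : Set H.V} :
    PIso G K H K' → PIso H K' G K := by
  rintro ⟨f, hf, rfl⟩
  obtain ⟨g, h1, h2⟩ := f.exists_inv hf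
  refine ⟨g, fun x => ⟨_, h1 x⟩, ?_⟩
  ext x
  constructor
  · rintro ⟨_, ⟨y, hy, rfl⟩, rfl⟩
    rw [h1]; exact hy
  · intro hx
    exact ⟨f.f x, ⟨x, hx, rfl⟩, h1 x⟩

theorem PIso.trans {G H I : CG L} {K : Set G.V} {K' : Set H.V} {K'' : Set I.V} :
    PIso G K H K' → PIso H K' I K'' → PIso G K I K'' := by
  rintro ⟨f, hf, rfl⟩ ⟨g, hg, rfl⟩
  exact ⟨g.comp f, hg.comp hf, (Set.image_image g.f f.f K).symm⟩

/-- Iterates of a self-embedding. -/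
def Emb.iter {G : CG L} (f : Emb G G) : ℕ → Emb G G
  | 0 => Emb.id G
  | n + 1 => f.comp (Emb.iter f n)

theorem pair_split {G H : CG L} {K : Set G.V} {K' : Set H.V} (hK : K.Finite) (hK' : K'.Finite)
    (φ : Emb G H) (hφ : φ.f '' K ⊆ K') (ψ : Emb H G) (hψ : ψ.f '' K' ⊆ K) :
    ∃ k' : Emb (ind G K) H, Set.range k'.f = K' ∧
      Eqv (Rest G (indEmb G K)) (Rest H k') ∧
      (Iso (Rest G (indEmb G K)) (Rest H k') → PIso G K H K') := by
  have : Finite K := hK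
  let θ := ψ.comp φ
  have hθ : ∀ x ∈ K, θ.f x ∈ K := fun x hx => hψ ⟨_, hφ ⟨x, hx, rfl⟩, rfl⟩
  let s : K → K := fun x => ⟨θ.f x.1, hθ x.1 x.2⟩
  have hs : Function.Injective s := fun x y h =>
    Subtype.ext (θ.inj (congrArg Subtype.val h))
  let σ : Equiv.Perm K := Equiv.ofBijective s (Finite.injective_iff_bijective.1 hs)
  have hit : ∀ n (x : K), (θ.iter n).f x.1 = ((σ ^ n) x).1 := by
    intro n
    induction n with
    | zero => intro x; rfl
    | succ n ih =>
      intro x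
      rw [pow_succ']
      show θ.f ((θ.iter n).f x.1) = _
      rw [ih]
      rfl
  have hpos : 0 < orderOf σ := orderOf_pos σ
  obtain ⟨n, hn⟩ : ∃ n, orderOf σ = n + 1 := ⟨orderOf σ - 1, by omega⟩
  have hcomm : ∀ n x, (θ.iter n).f (θ.f x) = θ.f ((θ.iter n).f x) := by
    intro n
    induction n with
    | zero => intro x; rfl
    | succ n ih =>
      intro x
      show θ.f ((θ.iter n).f (θ.f x)) = θ.f (θ.f ((θ.iter n).f x))
      rw [ih]
  let ψ' := (θ.iter n).comp ψ
  have hψ' : ∀ x ∈ K, ψ'.f (φ.f x) = x := by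
    intro x hx
    show (θ.iter n).f (θ.f x) = x
    rw [hcomm]
    have := hit (n + 1) ⟨x, hx⟩
    rw [← hn, pow_orderOf_eq_one] at this
    exact (by rw [hn] at this; exact this)
  let k' := φ.comp (indEmb G K)
  have hr : Set.range k'.f = φ.f '' K := by
    ext y
    constructor
    · rintro ⟨x, rfl⟩
      exact ⟨x.1, x.2, rfl⟩
    · rintro ⟨x, hx, rfl⟩
      exact ⟨⟨x, hx⟩, rfl⟩
  have hr' : φ.f '' K = K' := by
    refine Set.eq_of_subset_of_ncard_le hφ ?_ hK'
    rw [Set.ncard_image_of_injective K φ.inj, ← Set.ncard_image_of_injective K' ψ.inj]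
    exact Set.ncard_le_ncard hψ hK
  refine ⟨k', hr.trans hr', ⟨rest_map φ fun a => rfl, rest_map ψ' fun a => hψ' a.1 a.2⟩, ?_⟩
  rintro ⟨e, he⟩
  obtain ⟨f0, hf0, hf0k⟩ := asm_rest G (indEmb G K)
  obtain ⟨f1, hf1, hf1k⟩ := asm_rest H k'
  obtain ⟨g0, h1, h2⟩ := f0.exists_inv hf0
  have hval : ∀ x (hx : x ∈ K), (f1.comp ((asmMap e).comp g0)).f x = φ.f x := by
    intro x hx
    have h3 : f0.f (Sum.inl ⟨x, hx⟩) = x := hf0k ⟨x, hx⟩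
    have h4 : g0.f x = Sum.inl ⟨x, hx⟩ := by
      have := h1 (Sum.inl ⟨x, hx⟩)
      rw [h3] at this
      exact this
    show f1.f ((asmMap e).f (g0.f x)) = φ.f x
    rw [h4]
    exact hf1k ⟨x, hx⟩
  refine ⟨f1.comp ((asmMap e).comp g0), hf1.comp ((asmMap_surj e he).comp fun x => ⟨_, h1 x⟩), ?_⟩
  rw [← hr']
  exact Set.image_congr fun x hx => hval x hx

theorem finite_class {A : CG L} [Finite A.V] (F : ℕ → CG (L × Set A.V))
    (hF : ∀ n m, n ≠ m → ¬ Iso (F n) (F m)) (i : ℕ) :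
    {j | PIso (Asm A (F i)) (core A (F i)) (Asm A (F j)) (core A (F j))}.Finite := by
  have hch : ∀ j : {j | PIso (Asm A (F i)) (core A (F i)) (Asm A (F j)) (core A (F j))},
      ∃ (γ : Emb (Asm A (F i)) (Asm A (F j.1))) (p : A.V → A.V), Function.Surjective γ.f ∧
        Function.Surjective p ∧ ∀ a, γ.f (Sum.inl a) = Sum.inl (p a) := by
    rintro ⟨j, γ, hγ, hγc⟩
    have : ∀ a : A.V, ∃ b : A.V, γ.f (Sum.inl a) = Sum.inl b := by
      intro a
      have h1 : γ.f (Sum.inl a) ∈ core A (F j) := hγc ▸ ⟨Sum.inl a, ⟨a, rfl⟩, rfl⟩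
      obtain ⟨b, hb⟩ := h1
      exact ⟨b, hb.symm⟩
    choose p hp using this
    refine ⟨γ, p, hγ, ?_, hp⟩
    intro b
    have h1 : (Sum.inl b : (Asm A (F j)).V) ∈ γ.f '' core A (F i) := by
      rw [hγc]; exact ⟨b, rfl⟩
    obtain ⟨_, ⟨a, rfl⟩, ha⟩ := h1
    have ha : γ.f (Sum.inl a) = Sum.inl b := ha
    rw [hp] at ha
    exact ⟨a, Sum.inl.inj ha⟩
  choose γ p hγ hp hγp using hch
  refine Set.finite_coe_iff.1 (Finite.of_injective p ?_)
  intro j j' hjj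
  by_contra hne
  have hne : j.1 ≠ j'.1 := fun h => hne (Subtype.ext h)
  obtain ⟨g, h1, h2⟩ := (γ j).exists_inv (hγ j)
  refine hF _ _ hne (asm_restrict ((γ j').comp g) ?_ ((hγ j').comp fun x => ⟨_, h1 x⟩))
  intro a
  obtain ⟨b, rfl⟩ := hp j a
  show (γ j').f (g.f (Sum.inl (p j b))) = _
  have e3 : g.f (Sum.inl (p j b)) = Sum.inl b :=
    (congrArg g.f (hγp j b)).symm.trans (h1 (Sum.inl b))
  exact (congrArg (γ j').f e3).trans ((hγp j' b).trans (by rw [hjj]))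

theorem exists_subseq {A : CG L} [Finite A.V] (F : ℕ → CG (L × Set A.V))
    (hF : ∀ n m, n ≠ m → ¬ Iso (F n) (F m)) (G : CG L) (K : Set G.V) :
    ∃ g : ℕ → ℕ, (∀ i, ¬ PIso G K (Asm A (F (g i))) (core A (F (g i)))) ∧
      ∀ i j, i ≠ j → ¬ PIso (Asm A (F (g i))) (core A (F (g i)))
        (Asm A (F (g j))) (core A (F (g j))) := by
  let r : ℕ → ℕ → Prop := fun i j =>
    ¬ PIso (Asm A (F i)) (core A (F i)) (Asm A (F j)) (core A (F j))
  have hsymm : Std.Symm r := ⟨fun i j h h' => h h'.symm⟩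
  have hbad : {j | PIso G K (Asm A (F j)) (core A (F j))}.Finite := by
    by_cases h : ∃ i, PIso G K (Asm A (F i)) (core A (F i))
    · obtain ⟨i, hi⟩ := h
      exact (finite_class F hF i).subset fun j hj => hi.symm.trans hj
    · push Not at h
      convert Set.finite_empty (α := ℕ)
      ext j
      simpa using h j
  obtain ⟨g, h1, h2⟩ := exists_seq_of_forall_finset_exists'
    (fun j => ¬ PIso G K (Asm A (F j)) (core A (F j))) r (by
      intro s _
      have hfin : ({j | PIso G K (Asm A (F j)) (core A (F j))} ∪
          ⋃ i ∈ s, {j | PIso (Asm A (F i)) (core A (F i)) (Asm A (F j)) (core A (F j))}).Finite :=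
        hbad.union (s.finite_toSet.biUnion fun i _ => finite_class F hF i)
      obtain ⟨y, hy⟩ := hfin.exists_notMem
      refine ⟨y, fun h => hy (Or.inl h), fun x hx h => hy (Or.inr ?_)⟩
      exact Set.mem_biUnion hx h)
  exact ⟨g, h1, fun i j hij => h2 hij⟩

theorem exists_min_rank {V : Type u} {G : SimpleGraph V} {α : Ordinal.{u}} {U : Set V}
    (h : Rk G α U) : ∃ β ≤ α, Rk G β U ∧ ∀ γ < β, ¬ Rk G γ U := by
  induction α using WellFoundedLT.induction with
  | ind α ih =>
    by_cases hh : ∃ γ < α, Rk G γ U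
    · obtain ⟨γ, hγ, hR⟩ := hh
      obtain ⟨β, hβ, h1⟩ := ih γ hγ hR
      exact ⟨β, hβ.trans hγ.le, h1⟩
    · push Not at hh
      exact ⟨α, le_rfl, h, hh⟩

theorem ker_nonempty {V : Type u} {G : SimpleGraph V} {α : Ordinal.{u}} {K : Set V}
    (hG : Cn G Set.univ) (hmin : ∀ γ < α, ¬ Rk G γ Set.univ) (hK : IsKer G α K) :
    K.Nonempty := by
  by_contra h
  rw [Set.not_nonempty_iff_eq_empty] at h
  subst h
  obtain ⟨β, hβ, hR⟩ := hK.1.2 Set.univ hG (Set.disjoint_empty _)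
  exact hmin β hβ hR

theorem noDouble {C : CG L} {α : Ordinal.{u}} (hC : Conn C) (h : Rk C.G α Set.univ) :
    NoDouble C := by
  obtain ⟨β, -, hR, hmin⟩ := exists_min_rank h
  obtain ⟨K, hK⟩ := exists_ker hR
  obtain ⟨x, hx⟩ := ker_nonempty hC hmin hK
  intro f g
  have hgK : g.f '' K = K := by
    refine Set.eq_of_subset_of_ncard_le (hK.map g.inj g.adj hK) ?_ hK.1.1
    rw [Set.ncard_image_of_injective K g.inj]
  have hfx : f.f x ∈ K := hK.map f.inj f.adj hK ⟨x, hx, rfl⟩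
  rw [← hgK] at hfx
  obtain ⟨y, -, hy⟩ := hfx
  exact ⟨x, y, hy.symm⟩

theorem rest_cn {A G : CG L} (k : Emb A G) (W : Set G.V) (hW : W ⊆ {v | v ∉ Set.range k.f})
    (h : Cn G.G W) : Cn (Rest G k).G {v | v.1 ∈ W} := by
  refine Cn.of_image (H := G.G) (fun v : {v : G.V // v ∉ Set.range k.f} => v.1)
    Subtype.val_injective (fun _ _ => Iff.rfl) ?_
  convert h using 1
  ext x
  constructor
  · rintro ⟨y, hy, rfl⟩
    exact hy
  · intro hx
    exact ⟨⟨x, hW hx⟩, hx, rfl⟩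

theorem att_rest {A G : CG L} (k : Emb A G) (hG : Conn G) (hA : Nonempty A.V) :
    Att {p : L × Set A.V | p.2.Nonempty} (Rest G k) := by
  rintro ⟨v, hv⟩
  obtain ⟨a0⟩ := hA
  have hvU : v ∈ Set.univ \ Set.range k.f := ⟨trivial, hv⟩
  obtain ⟨a, ha, t, -, ⟨b, rfl⟩, hat⟩ :=
    comp_edge G.G (S := Set.range k.f) (s := k.f a0) hG hvU trivial ⟨a0, rfl⟩
  have hsub : _root_.comp G.G (Set.univ \ Set.range k.f) v ⊆ {v | v ∉ Set.range k.f} :=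
    fun x hx => (comp_sub G.G _ v hx).2
  refine ⟨_, rest_cn k _ hsub (comp_cn G.G hvU), mem_comp G.G hvU, ⟨a, hsub ha⟩, ha, ?_⟩
  exact ⟨b, hat⟩

theorem Cn.sub_closed {V : Type*} {G : SimpleGraph V} {W M : Set V} (hW : Cn G W)
    (hcl : ∀ a ∈ M, ∀ b, G.Adj a b → b ∈ M) {x : V} (hx : x ∈ W) (hxM : x ∈ M) : W ⊆ M := by
  have := hW.2 (M ∩ W) Set.inter_subset_right ⟨x, hxM, hx⟩ ?_
  · exact fun y hy => (this hy).1
  · rintro a ⟨ha, -⟩ b hb hab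
    exact ⟨hcl a ha b hab, hb⟩

theorem asm_conn {A : CG L} {B B' : CG (L × Set A.V)} (hA : Nonempty A.V)
    (hB : Conn (Asm A B)) (e : Emb B B') (hB' : Att {p : L × Set A.V | p.2.Nonempty} B') :
    Conn (Asm A B') := by
  obtain ⟨a0⟩ := hA
  refine ⟨⟨Sum.inl a0, trivial⟩, ?_⟩
  rintro M - ⟨m, hm⟩ hcl
  have hcl : ∀ a ∈ M, ∀ b, (Asm A B').G.Adj a b → b ∈ M := fun a ha b hab =>
    hcl a ha b trivial hab
  have h0 : Cn (Asm A B').G ((asmMap e).f '' Set.univ) := hB.image _ (asmMap e).adj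
  have hconn : ∀ x : B'.V, ∃ W, Cn (Asm A B').G W ∧ (Sum.inr x : (Asm A B').V) ∈ W ∧
      ∃ a : A.V, (Sum.inl a : (Asm A B').V) ∈ W := by
    intro x
    obtain ⟨W, hW, hxW, w, hw, a, ha⟩ := hB' x
    have h1 : Cn (Asm A B').G (Sum.inr '' W) := hW.image Sum.inr fun _ _ => Iff.rfl
    have h2 : (Asm A B').G.Adj (Sum.inr w) (Sum.inl a) := ha
    exact ⟨_, h1.insert ⟨w, hw, rfl⟩ h2, Or.inr ⟨x, hxW, rfl⟩, a, Or.inl rfl⟩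
  have hmem : ∀ a : A.V, (Sum.inl a : (Asm A B').V) ∈ (asmMap e).f '' Set.univ :=
    fun a => ⟨Sum.inl a, trivial, rfl⟩
  have hinl : ∃ a : A.V, (Sum.inl a : (Asm A B').V) ∈ M := by
    rcases m with a | x
    · exact ⟨a, hm⟩
    · obtain ⟨W, hW, hxW, a, ha⟩ := hconn x
      exact ⟨a, Cn.sub_closed hW hcl hxW hm ha⟩
  obtain ⟨a, ha⟩ := hinl
  have hall := Cn.sub_closed h0 hcl (hmem a) ha
  rintro (b | x) -
  · exact hall (hmem b)
  · obtain ⟨W, hW, hxW, b, hb⟩ := hconn x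
    exact Cn.sub_closed hW hcl hb (hall (hmem b)) hxW

end CG

open CG in
theorem theoremA (α : Ordinal.{u}) : ∀ (L : Type u) (C : CG L), Conn C →
    Rk C.G α Set.univ → (∀ γ < α, ¬ Rk C.G γ Set.univ) → TwinsInf C := by
  induction α using WellFoundedLT.induction with
  | ind α ih =>
    intro L C hC hR hmin D hD hDC hDi
    obtain ⟨⟨ψ⟩, ⟨φ⟩⟩ := hDC
    have hRD : Rk D.G α Set.univ :=
      hR.pullback ψ.f ψ.inj ψ.adj α _ _ (Set.subset_univ _)
    obtain ⟨K, hK⟩ := exists_ker hR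
    obtain ⟨K', hK'⟩ := exists_ker hRD
    have hKne := ker_nonempty hC hmin hK
    obtain ⟨k', hk', heq, hiso⟩ := pair_split hK.1.1 hK'.1.1 φ (hK.map φ.inj φ.adj hK') ψ
      (hK'.map ψ.inj ψ.adj hK)
    have hniso : ¬ Iso (Rest C (indEmb C K)) (Rest D k') := by
      intro h
      obtain ⟨f, hf, -⟩ := hiso h
      exact hDi (Iso.symm ⟨f, hf⟩)
    have hAne : Nonempty (ind C K).V := hKne.to_subtype
    have hAfin : Finite (ind C K).V := hK.1.1
    have hrange : Set.range (indEmb C K).f = K := Subtype.range_val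
    obtain ⟨F, hF1, hF2, hF3⟩ := theoremB (att_rest (indEmb C K) hC hAne)
      (att_rest k' hD hAne) heq hniso (by
        rintro E hE ⟨f⟩
        have hcn : Cn C.G ((fun x => (f.f x).1) '' Set.univ) := 
          Cn.image (H := C.G) (fun x => (f.f x).1) f.adj hE
        obtain ⟨β, hβ, hRβ⟩ := hK.1.2 _ hcn (by
          rw [Set.disjoint_left]
          rintro _ ⟨x, -, rfl⟩ hx
          exact (f.f x).2 ⟨⟨(f.f x).1, hx⟩, rfl⟩)
        have hRE : Rk E.G β Set.univ := hRβ.pullback (fun x => (f.f x).1)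
          (fun x y h => f.inj (Subtype.ext h)) f.adj β _ _ subset_rfl
        obtain ⟨γ, hγ, hRγ, hminγ⟩ := exists_min_rank hRE
        exact ⟨ih γ (hγ.trans_lt hβ) _ E hE hRγ hminγ, noDouble hE hRE⟩)
    obtain ⟨f0, hf0, hf0k⟩ := asm_rest C (indEmb C K)
    obtain ⟨g0, hg1, hg2⟩ := f0.exists_inv hf0
    have hg0k : ∀ a : (ind C K).V, g0.f a.1 = Sum.inl a := by
      intro a
      have := hg1 (Sum.inl a)
      rw [hf0k] at this
      exact this
    have hasm : Conn (Asm (ind C K) (Rest C (indEmb C K))) := by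
      have h1 : Cn (Asm (ind C K) (Rest C (indEmb C K))).G (g0.f '' Set.univ) :=
        hC.image _ g0.adj
      have h2 : g0.f '' Set.univ = Set.univ := by
        rw [Set.image_univ]
        exact Set.range_eq_univ.2 fun x => ⟨_, hg1 x⟩
      rw [h2] at h1
      exact h1
    have heqv : ∀ n, Eqv (Asm (ind C K) (F n)) C := by
      intro n
      obtain ⟨⟨a⟩, ⟨b⟩⟩ := hF1 n
      exact ⟨⟨f0.comp (asmMap a)⟩, ⟨(asmMap b).comp g0⟩⟩
    have hker : ∀ n, IsKer (Asm (ind C K) (F n)).G α (core (ind C K) (F n)) := by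
      intro n
      obtain ⟨⟨a⟩, ⟨b⟩⟩ := hF1 n
      let d := f0.comp (asmMap a)
      let e := (asmMap b).comp g0
      have hRn : Rk (Asm (ind C K) (F n)).G α Set.univ :=
        hR.pullback d.f d.inj d.adj α _ _ (Set.subset_univ _)
      obtain ⟨Kn, hKn⟩ := exists_ker hRn
      have h1 := hK.map e.inj e.adj hKn
      have h2 := hKn.map d.inj d.adj hK
      have : Kn = core (ind C K) (F n) := by
        apply Set.Subset.antisymm
        · intro x hx
          have hx' : d.f x ∈ K := h2 ⟨x, hx, rfl⟩
          have h3 : d.f (Sum.inl ⟨d.f x, hx'⟩) = d.f x := hf0k ⟨d.f x, hx'⟩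
          exact ⟨_, d.inj h3⟩
        · rintro _ ⟨y, rfl⟩
          apply h1
          refine ⟨y.1, y.2, ?_⟩
          show (asmMap b).f (g0.f y.1) = _
          rw [hg0k]
          rfl
      rw [← this]
      exact hKn
    obtain ⟨g, -, hg⟩ := exists_subseq F hF3 C K
    refine ⟨fun n => Asm (ind C K) (F (g n)), ?_, ?_⟩
    · intro n
      obtain ⟨b⟩ := (hF1 (g n)).2
      exact ⟨asm_conn hAne hasm b (hF2 (g n)), heqv (g n)⟩
    · rintro n m hnm ⟨γ, hγ⟩
      refine hg n m hnm ⟨γ, hγ, ?_⟩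
      apply Set.Subset.antisymm
      · exact (hker _).map γ.inj γ.adj (hker _)
      · obtain ⟨δ, h1, h2⟩ := γ.exists_inv hγ
        intro x hx
        exact ⟨δ.f x, (hker _).map δ.inj δ.adj (hker _) ⟨x, hx, rfl⟩, h2 x⟩

theorem induce_cn {V : Type u} (G : SimpleGraph V) (U : Set V) :
    (G.induce U).Connected ↔ Cn G U := by
  rw [connected_iff_cn]
  have himg : (Subtype.val : U → V) '' Set.univ = U := by simp
  constructor
  · intro h
    have := h.image (H := G) Subtype.val fun _ _ => Iff.rfl
    rwa [himg] at this
  · intro h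
    refine Cn.of_image (H := G) Subtype.val Subtype.val_injective (fun _ _ => Iff.rfl) ?_
    rwa [himg]

open CG in
theorem rest_conn {L : Type u} {A G : CG L} (k : Emb A G) (X : Set G.V)
    (hX : Set.range k.f = X) (h : Cn G.G Xᶜ) : Conn (Rest G k) := by
  subst hX
  have := rest_cn k _ subset_rfl h
  unfold Conn
  refine cast (congrArg (Cn _) ?_) this
  exact Set.eq_univ_of_forall fun x => x.2
/-- If the pairs `(G, X)` and `(H, Y)` (with `G`, `H` rayless, `X`, `Y` finite, and
`G − X`, `H − Y` connected) are strong twins, then `(G, X)` has infinitely many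
pairwise non-isomorphic connected strong twins. -/
theorem connected_strongTwinPairs_infinite {V W : Type u}
    (G : SimpleGraph V) (H : SimpleGraph W)
    (X : Set V) (Y : Set W) (hX : X.Finite) (hY : Y.Finite)
    (hG : G.IsRayless) (hH : H.IsRayless)
    (hGc : (G.induce Xᶜ).Connected) (hHc : (H.induce Yᶜ).Connected)
    (htwin : StrongTwinPairs G X H Y) :
    ∃ F : ℕ → Σ W' : Type u, SimpleGraph W' × Set W',
      (∀ i, (F i).2.2.Finite) ∧
      (∀ i, ((F i).2.1.induce ((F i).2.2)ᶜ).Connected) ∧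
      (∀ i j, i ≠ j → ¬ PairIso (F i).2.1 (F i).2.2 (F j).2.1 (F j).2.2) ∧
      ∀ i, StrongTwinPairs G X (F i).2.1 (F i).2.2 := by
  classical
  obtain ⟨hniso, ⟨φ, hφ⟩, ⟨ψ, hψ⟩⟩ := htwin
  let A : CG PUnit.{u + 1} := ⟨V, G, fun _ => PUnit.unit⟩
  let B : CG PUnit.{u + 1} := ⟨W, H, fun _ => PUnit.unit⟩
  let φ' : CG.Emb A B := ⟨φ, φ.injective, fun _ _ => φ.map_rel_iff, fun _ => rfl⟩
  let ψ' : CG.Emb B A := ⟨ψ, ψ.injective, fun _ _ => ψ.map_rel_iff, fun _ => rfl⟩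
  obtain ⟨k', hk', heq, hiso⟩ := CG.pair_split (G := A) (H := B) hX hY φ' hφ ψ' hψ
  have hGX : Cn G Xᶜ := (induce_cn G Xᶜ).1 hGc
  have hHY : Cn H Yᶜ := (induce_cn H Yᶜ).1 hHc
  let k := CG.indEmb A X
  have hk : Set.range k.f = X := Subtype.range_val
  have hc : CG.Conn (CG.Rest A k) := rest_conn k X hk hGX
  have hc' : CG.Conn (CG.Rest B k') := rest_conn k' Y hk' hHY
  have hne : ¬ CG.Iso (CG.Rest B k') (CG.Rest A k) := by
    intro h
    obtain ⟨f, hf, hfX⟩ := hiso h.symm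
    apply hniso
    exact ⟨⟨Equiv.ofBijective f.f ⟨f.inj, hf⟩, fun {a b} => f.adj a b⟩, hfX⟩
  obtain ⟨α, hα⟩ := rayless_ranked G hG
  have hRr : Rk (CG.Rest A k).G α Set.univ :=
    hα.pullback (fun v : {v : V // v ∉ Set.range k.f} => v.1) Subtype.val_injective
      (fun _ _ => Iff.rfl) α _ _ (Set.subset_univ _)
  obtain ⟨β, -, hRβ, hmin⟩ := CG.exists_min_rank hRr
  obtain ⟨F, hF1, hF2⟩ := theoremA β _ _ hc hRβ hmin (CG.Rest B k') hc' heq.symm hne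
  have hfin : Finite (CG.ind A X).V := hX
  obtain ⟨g, hg1, hg2⟩ := CG.exists_subseq F hF2 A X
  have conv : ∀ (P Q : CG PUnit.{u + 1}) (S : Set P.V) (T : Set Q.V),
      PairIso P.G S Q.G T → CG.PIso P S Q T := by
    rintro P Q S T ⟨γ, hγ⟩
    exact ⟨⟨γ, γ.injective, fun _ _ => γ.map_rel_iff, fun _ => rfl⟩, γ.surjective, hγ⟩
  obtain ⟨f0, hf0, hf0k⟩ := CG.asm_rest A k
  obtain ⟨g0, hg01, hg02⟩ := f0.exists_inv hf0
  refine ⟨fun n => ⟨(CG.Asm (CG.ind A X) (F (g n))).V, (CG.Asm (CG.ind A X) (F (g n))).G,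
    CG.core (CG.ind A X) (F (g n))⟩, ?_, ?_, ?_, ?_⟩
  · intro i
    exact Set.finite_range _
  · intro i
    rw [induce_cn]
    have h1 : Cn (CG.Asm (CG.ind A X) (F (g i))).G (Sum.inr '' Set.univ) :=
      (hF1 (g i)).1.image Sum.inr fun _ _ => Iff.rfl
    convert h1 using 1
    ext x
    rcases x with a | x
    · constructor
      · intro h
        exact absurd ⟨a, rfl⟩ h
      · rintro ⟨y, -, hy⟩
        cases hy
    · constructor
      · intro _
        exact ⟨x, trivial, rfl⟩
      · rintro _ ⟨y, hy⟩
        cases hy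
  · intro i j hij h
    exact hg2 i j hij (conv _ _ _ _ h)
  · intro i
    obtain ⟨⟨a⟩, ⟨b⟩⟩ := (hF1 (g i)).2
    let d := f0.comp (CG.asmMap a)
    let e := (CG.asmMap b).comp g0
    refine ⟨fun h => hg1 i (conv A (CG.Asm (CG.ind A X) (F (g i))) _ _ h),
      ⟨⟨⟨e.f, e.inj⟩, fun {x y} => e.adj x y⟩, ?_⟩, ⟨⟨⟨d.f, d.inj⟩, fun {x y} => d.adj x y⟩, ?_⟩⟩
    · rintro _ ⟨x, hx, rfl⟩
      refine ⟨⟨x, hx⟩, ?_⟩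
      have h1 : g0.f x = Sum.inl ⟨x, hx⟩ :=
        (congrArg g0.f (hf0k ⟨x, hx⟩)).symm.trans (hg01 (Sum.inl ⟨x, hx⟩))
      exact (congrArg (CG.asmMap b).f h1).symm
    · rintro _ ⟨_, ⟨y, rfl⟩, rfl⟩
      have h1 : d.f (Sum.inl y) = y.1 := hf0k y
      show d.f (Sum.inl y) ∈ X
      rw [h1]
      exact y.2
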